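/- arXiv:math/0005202 — 2 statements merged into one kernel-verified Lean document; each statement's English description precedes it below -/
import Mathlib

section
/- Let S ⊂ P^N, N ≥ 4, be an integral non-degenerate surface such that the projection of S from a general point A ∈ S is a cone. Then S itself is a cone. -/
open Submodule

noncomputable section

/-- Polynomial functions on a complex module: the subalgebra of functions generated by
the linear functionals. -/
def PolyFun (W : Type*) [AddCommGroup W] [Module ℂ W] : Subalgebra ℂ (W → ℂ) :=
  Algebra.adjoin ℂ {f : W → ℂ | IsLinearMap ℂ f}

/-- A subset of a complex module is algebraic (Zariski closed) if it is the common zero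
set of a family of polynomial functions. -/
def IsAlgSet {W : Type*} [AddCommGroup W] [Module ℂ W] (X : Set W) : Prop :=
  ∃ S : Set (W → ℂ), S ⊆ (PolyFun W : Set (W → ℂ)) ∧ X = {x | ∀ f ∈ S, f x = 0}

/-- Zariski closure. -/
def zcl {W : Type*} [AddCommGroup W] [Module ℂ W] (A : Set W) : Set W :=
  ⋂₀ {Y | IsAlgSet Y ∧ A ⊆ Y}

/-- Irreducible algebraic set. -/
def IsIrrAlg {W : Type*} [AddCommGroup W] [Module ℂ W] (X : Set W) : Prop :=
  X.Nonempty ∧ IsAlgSet X ∧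
    ∀ Y Z : Set W, IsAlgSet Y → IsAlgSet Z → X ⊆ Y ∪ Z → X ⊆ Y ∨ X ⊆ Z

/-- Dimension of an (affine) algebraic set: the supremum of the lengths of strict chains
of irreducible algebraic subsets contained in it. -/
def adim {W : Type*} [AddCommGroup W] [Module ℂ W] (X : Set W) : ℕ∞ :=
  sSup {d : ℕ∞ | ∃ n : ℕ, d = (n : ℕ∞) ∧
    ∃ c : Fin (n + 1) → Set W, StrictMono c ∧ ∀ i, IsIrrAlg (c i) ∧ c i ⊆ X}

/-- Projective dimension of a cone: one less than the dimension of the affine cone. -/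
def pdim {W : Type*} [AddCommGroup W] [Module ℂ W] (X : Set W) : ℕ∞ := adim X - 1

/-- A cone in a complex module (the affine cone of a projective set). -/
def IsCone {W : Type*} [AddCommGroup W] [Module ℂ W] (X : Set W) : Prop :=
  (0 : W) ∈ X ∧ ∀ (c : ℂ) (x : W), x ∈ X → c • x ∈ X

/-- The affine cone of an integral projective variety: an irreducible algebraic cone,
different from the origin alone. -/
def IsProjVar {W : Type*} [AddCommGroup W] [Module ℂ W] (X : Set W) : Prop :=
  IsAlgSet X ∧ IsCone X ∧ IsIrrAlg X ∧ X ≠ {0}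

/-- Non-degenerate: the cone spans the ambient space. -/
def Nondeg {W : Type*} [AddCommGroup W] [Module ℂ W] (X : Set W) : Prop :=
  Submodule.span ℂ X = ⊤

/-- The projective set is a cone over some vertex: there is a point `v` (vertex) of the
variety such that the variety is a union of lines through the vertex. -/
def IsConeVar {W : Type*} [AddCommGroup W] [Module ℂ W] (X : Set W) : Prop :=
  ∃ v ∈ X, v ≠ 0 ∧ ∀ x ∈ X, ∀ a b : ℂ, a • v + b • x ∈ X

/-- Affine cone of the `k`-th secant variety `S_k(X)`: the Zariski closure of the union
of the linear spans of `k+1` points of `X`. -/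
def Sec {W : Type*} [AddCommGroup W] [Module ℂ W] (X : Set W) (k : ℕ) : Set W :=
  zcl (⋃ p ∈ {p : Fin (k + 1) → W | ∀ i, p i ∈ X},
    (Submodule.span ℂ (Set.range p) : Set W))


/-- In characteristic zero, a field is formally smooth over each of its subrings. -/
theorem formallySmooth_of_injective {R K : Type} [CommRing R] [Field K] [CharZero K]
    [Algebra R K] (hinj : Function.Injective (algebraMap R K)) : Algebra.FormallySmooth R K := by
  have : FaithfulSMul R K := (faithfulSMul_iff_algebraMap_injective R K).2 hinj
  have : IsDomain R := IsDomain.of_faithfulSMul R K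
  let : Algebra (FractionRing R) K := FractionRing.liftAlgebra R K
  have : IsScalarTower R (FractionRing R) K := FractionRing.isScalarTower_liftAlgebra R K
  have : CharZero (FractionRing R) :=
    (algebraMap (FractionRing R) K).charZero_iff (algebraMap (FractionRing R) K).injective |>.2
      inferInstance
  obtain ⟨ι, v, hv⟩ := exists_isTranscendenceBasis' (FractionRing R) K
  have := hv.isAlgebraic_field
  have : Algebra.FormallySmooth (FractionRing R) K :=
    Algebra.FormallySmooth.of_algebraicIndependent_of_isSeparable hv.1
  have : Algebra.FormallySmooth R (FractionRing R) := .of_isLocalization (nonZeroDivisors R)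
  exact .comp R (FractionRing R) K

/-- Square-zero lifting of a partially defined section along `B → K`, for `K` a field of
characteristic zero. -/
theorem exists_section_of_subring {R K B : Type} [CommRing R] [Field K] [CharZero K]
    [CommRing B] (i : R →+* K) (hi : Function.Injective i) (ψ : R →+* B) (π : B →+* K)
    (hπ : Function.Surjective π) (hnil : IsNilpotent (RingHom.ker π))
    (hcomp : π.comp ψ = i) :
    ∃ s : K →+* B, s.comp i = ψ ∧ π.comp s = RingHom.id K := by
  let : Algebra R K := i.toAlgebra
  let : Algebra R B := ψ.toAlgebra
  have := formallySmooth_of_injective (R := R) (K := K) hi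
  let g : B →ₐ[R] K := { π with commutes' := fun r => RingHom.congr_fun hcomp r }
  have hg : Function.Surjective g := hπ
  have hker : RingHom.ker (g : B →+* K) = RingHom.ker π := rfl
  let f := Algebra.FormallySmooth.liftOfSurjective (AlgHom.id R K) g hg (by rw [hker]; exact hnil)
  refine ⟨f.toRingHom, ?_, ?_⟩
  · ext r
    exact f.commutes r
  · ext x
    exact Algebra.FormallySmooth.liftOfSurjective_apply (AlgHom.id R K) g hg _ x

/-- A first-order deformation of a (not necessarily injective) algebra map `P → K` that kills
its kernel extends to a derivation of the field `K`. -/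
theorem exists_derivation_extending {P K : Type} [CommRing P] [Algebra ℂ P] [Field K]
    [Algebra ℂ K] (φ : P →ₐ[ℂ] K) (ψ : P →ₐ[ℂ] TrivSqZeroExt K K)
    (hfst : ∀ p, (ψ p).fst = φ p) (hker : ∀ p, φ p = 0 → ψ p = 0) :
    ∃ D : Derivation ℂ K K, ∀ p, D (φ p) = (ψ p).snd := by
  have : CharZero K := charZero_of_injective_algebraMap (algebraMap ℂ K).injective
  let π : TrivSqZeroExt K K →ₐ[ℂ] K := TrivSqZeroExt.fstHom ℂ K K
  let q : P →+* P ⧸ RingHom.ker φ.toRingHom := Ideal.Quotient.mk _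
  let ψ' : P ⧸ RingHom.ker φ.toRingHom →+* TrivSqZeroExt K K :=
    Ideal.Quotient.lift _ ψ.toRingHom (fun a ha => hker a ha)
  obtain ⟨s, hs, hs'⟩ := exists_section_of_subring
    (RingHom.kerLift φ.toRingHom) (RingHom.kerLift_injective _) ψ' π.toRingHom
    (TrivSqZeroExt.fst_surjective)
    ⟨2, by
      rw [Submodule.zero_eq_bot, eq_bot_iff, pow_two, Ideal.mul_le]
      intro a ha b hb
      have ha' : a.fst = 0 := ha
      have hb' : b.fst = 0 := hb
      rw [Ideal.mem_bot]
      ext <;> simp [ha', hb']⟩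
    (by
      refine Ideal.Quotient.ringHom_ext ?_
      ext p
      exact hfst p)
  have hsφ : ∀ p, s (φ p) = ψ p := fun p => RingHom.congr_fun hs (q p)
  have hfs : ∀ x, (s x).fst = x := fun x => RingHom.congr_fun hs' x
  have hsC : ∀ c : ℂ, s (algebraMap ℂ K c) = algebraMap ℂ _ c := fun c => by
    rw [← φ.commutes c, hsφ, ψ.commutes]
  refine ⟨Derivation.mk'
    { toFun := fun x => (s x).snd
      map_add' := fun x y => by simp
      map_smul' := fun c x => by
        rw [Algebra.smul_def, map_mul, hsC, ← Algebra.smul_def]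
        simp }
    (fun a b => by
      simp [hfs, mul_comm]), fun p => ?_⟩
  simp [hsφ]

/-- An element of a field over `ℂ` killed by all derivations is a constant. -/
theorem mem_range_of_forall_derivation_eq_zero {K : Type} [Field K] [Algebra ℂ K] (g : K)
    (hg : ∀ D : Derivation ℂ K K, D g = 0) : ∃ c : ℂ, algebraMap ℂ K c = g := by
  by_cases halg : IsAlgebraic ℂ g
  · have hIntegral := halg.isIntegral
    exact minpoly.mem_range_of_degree_eq_one ℂ g
      (IsAlgClosed.degree_eq_one_of_irreducible ℂ (minpoly.irreducible hIntegral))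
  · exfalso
    obtain ⟨D, hD⟩ := exists_derivation_extending (Polynomial.aeval (R := ℂ) g)
      (Polynomial.aeval (TrivSqZeroExt.inl g + TrivSqZeroExt.inr (1 : K)))
      (fun p => by
        change TrivSqZeroExt.fstHom ℂ K K _ = _
        rw [← Polynomial.aeval_algHom_apply]
        simp)
      (fun p hp => by
        rw [(transcendental_iff.1 halg) p hp, map_zero])
    have := hD Polynomial.X
    rw [Polynomial.aeval_X, Polynomial.aeval_X, hg D] at this
    simp at this

/-- In characteristic zero a derivation vanishing on a subalgebra vanishes on every element
algebraic over it. -/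
theorem derivation_eq_zero_of_isAlgebraic {K : Type} [Field K] [Algebra ℂ K]
    (D : Derivation ℂ K K) (B : Subalgebra ℂ K) (hB : ∀ b ∈ B, D b = 0) (z : K)
    (hz : IsAlgebraic B z) : D z = 0 := by
  have : CharZero K := charZero_of_injective_algebraMap (algebraMap ℂ K).injective
  have : CharZero B := charZero_of_injective_algebraMap (algebraMap ℂ B).injective
  let D' : Derivation B K K := Derivation.mk'
    { toFun := D
      map_add' := fun x y => D.map_add x y
      map_smul' := fun b x => by
        rw [Subalgebra.smul_def, smul_eq_mul, D.leibniz, hB _ b.2]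
        simp [Subalgebra.smul_def] }
    (fun a b => D.leibniz a b)
  classical
  have hex : ∃ n : ℕ, ∃ p : Polynomial B, p ≠ 0 ∧ Polynomial.aeval z p = 0 ∧ p.natDegree = n := by
    obtain ⟨p, hp, hpz⟩ := hz
    exact ⟨_, p, hp, hpz, rfl⟩
  obtain ⟨p, hp, hpz, hpn⟩ := Nat.find_spec hex
  have hmin := fun m hm => Nat.find_min hex (m := m) hm
  rw [← hpn] at hmin
  have hdeg : p.natDegree ≠ 0 := by
    intro h0
    rw [Polynomial.eq_C_of_natDegree_eq_zero h0, Polynomial.aeval_C] at hpz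
    have h1 : p.coeff 0 = 0 := Subtype.ext hpz
    apply hp
    rw [Polynomial.eq_C_of_natDegree_eq_zero h0, h1, Polynomial.C_0]
  have hder : Polynomial.aeval z (Polynomial.derivative p) ≠ 0 := by
    intro h
    refine hmin _ (Polynomial.natDegree_derivative_lt hdeg)
      ⟨Polynomial.derivative p, fun h0 => hdeg ?_, h, rfl⟩
    exact Polynomial.derivative_eq_zero.1 h0
  have key : D' (Polynomial.aeval z p) = Polynomial.aeval z (Polynomial.derivative p) • D' z :=
    D'.map_aeval p z
  rw [hpz, map_zero] at key
  exact (smul_eq_zero.1 key.symm).resolve_left hder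

/-- The derivations of the function field of a domain which is integral over the image of a
polynomial ring in `s` variables form a vector space of dimension at most `s`. -/
theorem finrank_derivation_le {R K : Type} [CommRing R] [Algebra ℂ R] [Field K] [Algebra ℂ K]
    [Algebra R K] [IsScalarTower ℂ R K] [IsFractionRing R K] {s : ℕ}
    (g : MvPolynomial (Fin s) ℂ →ₐ[ℂ] R) (hg : g.IsIntegral) :
    Module.Finite K (Derivation ℂ K K) ∧ Module.finrank K (Derivation ℂ K K) ≤ s := by
  let y : Fin s → K := fun j => algebraMap R K (g (MvPolynomial.X j))
  let f : MvPolynomial (Fin s) ℂ →ₐ[ℂ] K := (IsScalarTower.toAlgHom ℂ R K).comp g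
  let ev : Derivation ℂ K K →ₗ[K] (Fin s → K) :=
    { toFun := fun D j => D (y j)
      map_add' := fun D D' => rfl
      map_smul' := fun c D => rfl }
  have hinj : Function.Injective ev := by
    rw [injective_iff_map_eq_zero]
    intro D hD
    have hB : ∀ b ∈ f.range, D b = 0 := by
      rintro _ ⟨p, rfl⟩
      change D (f p) = 0
      induction p using MvPolynomial.induction_on with
      | C a =>
        rw [← MvPolynomial.algebraMap_eq, f.commutes, D.map_algebraMap]
      | add p q hp hq => rw [map_add, map_add, hp, hq, add_zero]
      | mul_X p j hp =>
        have hj : D (f (MvPolynomial.X j)) = 0 := congr_fun hD j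
        rw [map_mul, D.leibniz, hp, hj]
        simp
    have hR : ∀ r : R, D (algebraMap R K r) = 0 := by
      intro r
      refine derivation_eq_zero_of_isAlgebraic D f.range hB _ (IsIntegral.isAlgebraic ?_)
      obtain ⟨p, hp, hpr⟩ := hg r
      refine ⟨p.map f.rangeRestrict.toRingHom, hp.map _, ?_⟩
      rw [Polynomial.eval₂_map]
      have h2 : (algebraMap f.range K).comp f.rangeRestrict.toRingHom =
          (algebraMap R K).comp g.toRingHom := by
        ext <;> rfl
      rw [h2, ← Polynomial.hom_eval₂]
      exact (congr_arg (algebraMap R K) hpr).trans (map_zero _)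
    ext z
    obtain ⟨a, b, -, rfl⟩ := IsFractionRing.div_surjective (A := R) z
    rw [D.leibniz_div, hR, hR]
    simp
  exact ⟨Module.Finite.of_injective ev hinj,
    (LinearMap.finrank_le_finrank_of_injective hinj).trans (by simp)⟩


section AlgebraicSets

open MvPolynomial

variable {n : ℕ}

theorem mem_polyFun_of_mvPolynomial (p : MvPolynomial (Fin n) ℂ) :
    (fun z : Fin n → ℂ => eval z p) ∈ PolyFun (Fin n → ℂ) := by
  induction p using MvPolynomial.induction_on with
  | C a =>
    simp only [eval_C]
    exact (PolyFun (Fin n → ℂ)).algebraMap_mem a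
  | add p q hp hq =>
    simp only [map_add]
    exact add_mem hp hq
  | mul_X p j hp =>
    simp only [map_mul, eval_X]
    refine mul_mem hp (Algebra.subset_adjoin ?_)
    exact ⟨fun _ _ => rfl, fun _ _ => rfl⟩

theorem exists_mvPolynomial_of_isLinearMap {f : (Fin n → ℂ) → ℂ} (hf : IsLinearMap ℂ f) :
    ∀ z, f z = eval z (∑ i, C (f (Pi.single i 1)) * X i : MvPolynomial (Fin n) ℂ) := by
  intro z
  have h := (hf.mk' f).pi_apply_eq_sum_univ z
  simp only [IsLinearMap.mk'_apply] at h
  rw [h]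
  simp only [map_sum, map_mul, eval_C, eval_X, smul_eq_mul]
  refine Finset.sum_congr rfl fun i _ => ?_
  rw [mul_comm]
  congr 2
  ext j
  simp [Pi.single_apply, eq_comm]

theorem mem_polyFun_iff {f : (Fin n → ℂ) → ℂ} :
    f ∈ PolyFun (Fin n → ℂ) ↔ ∃ p : MvPolynomial (Fin n) ℂ, ∀ z, f z = eval z p := by
  constructor
  · intro hf
    induction hf using Algebra.adjoin_induction with
    | mem f hf => exact ⟨_, exists_mvPolynomial_of_isLinearMap hf⟩
    | algebraMap c => exact ⟨C c, fun z => by simp⟩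
    | add f g _ _ hf hg =>
      obtain ⟨p, hp⟩ := hf
      obtain ⟨q, hq⟩ := hg
      exact ⟨p + q, fun z => by simp [hp, hq]⟩
    | mul f g _ _ hf hg =>
      obtain ⟨p, hp⟩ := hf
      obtain ⟨q, hq⟩ := hg
      exact ⟨p * q, fun z => by simp [hp, hq]⟩
  · rintro ⟨p, hp⟩
    rw [show f = fun z => eval z p from funext hp]
    exact mem_polyFun_of_mvPolynomial p

theorem isAlgSet_zeroLocus (I : Ideal (MvPolynomial (Fin n) ℂ)) :
    IsAlgSet (zeroLocus ℂ I) := by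
  refine ⟨(fun p z => eval z p) '' (I : Set (MvPolynomial (Fin n) ℂ)), ?_, ?_⟩
  · rintro _ ⟨p, -, rfl⟩
    exact mem_polyFun_of_mvPolynomial p
  · ext z
    simp [aeval_eq_eval]

theorem IsAlgSet.zeroLocus_vanishingIdeal {X : Set (Fin n → ℂ)} (hX : IsAlgSet X) :
    zeroLocus ℂ (vanishingIdeal ℂ X) = X := by
  refine Set.Subset.antisymm ?_ fun x hx p hp => hp x hx
  obtain ⟨T, hT, rfl⟩ := hX
  intro z hz f hf
  obtain ⟨p, hp⟩ := mem_polyFun_iff.1 (hT hf)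
  rw [hp, ← aeval_eq_eval]
  refine hz p fun x hx => ?_
  rw [aeval_eq_eval, ← hp]
  exact hx f hf

theorem IsIrrAlg.isPrime_vanishingIdeal {X : Set (Fin n → ℂ)} (hX : IsIrrAlg X) :
    (vanishingIdeal ℂ X).IsPrime := by
  obtain ⟨⟨x, hx⟩, -, hirr⟩ := hX
  refine ⟨fun h => ?_, fun {p q} hpq => ?_⟩
  · have h1 : (1 : MvPolynomial (Fin n) ℂ) ∈ vanishingIdeal ℂ X := h ▸ Submodule.mem_top
    simpa using h1 x hx
  · have hcov : X ⊆ zeroLocus ℂ (Ideal.span {p}) ∪ zeroLocus ℂ (Ideal.span {q}) := by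
      intro z hz
      have h := hpq z hz
      rw [map_mul, mul_eq_zero] at h
      simpa [zeroLocus_span] using h
    refine (hirr _ _ (isAlgSet_zeroLocus _) (isAlgSet_zeroLocus _) hcov).imp ?_ ?_ <;>
    · intro h z hz
      exact h hz _ (Ideal.mem_span_singleton_self _)

theorem isIrrAlg_zeroLocus (P : Ideal (MvPolynomial (Fin n) ℂ)) [hP : P.IsPrime] :
    IsIrrAlg (zeroLocus ℂ P) := by
  have hvan : vanishingIdeal ℂ (zeroLocus ℂ P) = P := IsPrime.vanishingIdeal_zeroLocus P
  refine ⟨?_, isAlgSet_zeroLocus P, fun Y Z hY hZ hcov => ?_⟩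
  · rw [Set.nonempty_iff_ne_empty]
    intro h
    rw [h, vanishingIdeal_empty] at hvan
    exact hP.ne_top hvan.symm
  · by_contra! hcon
    obtain ⟨hXY, hXZ⟩ := hcon
    rw [← hY.zeroLocus_vanishingIdeal, Set.not_subset] at hXY
    rw [← hZ.zeroLocus_vanishingIdeal, Set.not_subset] at hXZ
    obtain ⟨y, hy, hy'⟩ := hXY
    obtain ⟨z, hz, hz'⟩ := hXZ
    simp only [mem_zeroLocus_iff, not_forall] at hy' hz'
    obtain ⟨p, hp, hpy⟩ := hy'
    obtain ⟨q, hq, hqz⟩ := hz'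
    have hpq : p * q ∈ vanishingIdeal ℂ (zeroLocus ℂ P) := by
      intro x hx
      rw [map_mul]
      rcases hcov hx with h | h
      · rw [hp x h, zero_mul]
      · rw [hq x h, mul_zero]
    rw [hvan] at hpq
    rcases hP.mem_or_mem hpq with h | h
    · exact hpy (hy p h)
    · exact hqz (hz q h)

theorem length_le_adim {X : Set (Fin n → ℂ)} (hX : IsAlgSet X)
    (l : LTSeries (PrimeSpectrum (MvPolynomial (Fin n) ℂ)))
    (hl : ∀ i, vanishingIdeal ℂ X ≤ (l i).asIdeal) : (l.length : ℕ∞) ≤ adim X := by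
  refine le_sSup ⟨l.length, rfl, fun i => zeroLocus ℂ (l i.rev).asIdeal, ?_, fun i => ⟨?_, ?_⟩⟩
  · intro i j hij
    have hlt : l j.rev < l i.rev := l.strictMono (Fin.rev_lt_rev.2 hij)
    refine lt_of_le_of_ne (zeroLocus_anti_mono hlt.le) fun h => hlt.ne ?_
    have h' := congr_arg (vanishingIdeal ℂ) h
    simp only [IsPrime.vanishingIdeal_zeroLocus] at h'
    exact PrimeSpectrum.ext h'.symm
  · exact isIrrAlg_zeroLocus _
  · calc zeroLocus ℂ (l i.rev).asIdeal ≤ zeroLocus ℂ (vanishingIdeal ℂ X) :=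
          zeroLocus_anti_mono (hl _)
      _ = X := hX.zeroLocus_vanishingIdeal

/-- Noether normalization of the coordinate ring, in a number of variables bounded by the
chain dimension. -/
theorem exists_integral_le_adim {X : Set (Fin n → ℂ)} (hX : IsIrrAlg X) :
    ∃ (s : ℕ) (g : MvPolynomial (Fin s) ℂ →ₐ[ℂ] MvPolynomial (Fin n) ℂ ⧸ vanishingIdeal ℂ X),
      g.IsIntegral ∧ (s : ℕ∞) ≤ adim X := by
  have hprime := hX.isPrime_vanishingIdeal
  obtain ⟨s, -, g, hg, hIntegral⟩ :=
    exists_integral_inj_algHom_of_quotient (vanishingIdeal ℂ X) hprime.ne_top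
  refine ⟨s, g, hIntegral, ?_⟩
  let := g.toRingHom.toAlgebra
  have : Algebra.IsIntegral (MvPolynomial (Fin s) ℂ)
    (MvPolynomial (Fin n) ℂ ⧸ vanishingIdeal ℂ X) := ⟨hIntegral⟩
  have hdim : ringKrullDim (MvPolynomial (Fin s) ℂ) = s := by
    rw [MvPolynomial.ringKrullDim_of_isNoetherianRing]
    simp
  obtain ⟨l, hl⟩ : ∃ l : LTSeries (PrimeSpectrum (MvPolynomial (Fin s) ℂ)), l.length = s :=
    (Order.le_krullDim_iff (n := s)).1 hdim.ge
  have hker : RingHom.ker (algebraMap (MvPolynomial (Fin s) ℂ)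
      (MvPolynomial (Fin n) ℂ ⧸ vanishingIdeal ℂ X)) ≤ l.head.asIdeal := by
    refine le_of_eq_of_le ?_ bot_le
    exact (RingHom.injective_iff_ker_eq_bot
      (algebraMap (MvPolynomial (Fin s) ℂ) (MvPolynomial (Fin n) ℂ ⧸ vanishingIdeal ℂ X))).1 hg
  obtain ⟨P, hP, hPl⟩ := Ideal.exists_ideal_over_prime_of_isIntegral_of_isDomain
    l.head.asIdeal hker
  have : P.LiesOver l.head.asIdeal := ⟨hPl.symm⟩
  obtain ⟨L, hL, -⟩ := Ideal.exists_ltSeries_of_hasGoingUp l P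
  have hmono : StrictMono (PrimeSpectrum.comap (Ideal.Quotient.mk (vanishingIdeal ℂ X))) :=
    RingHom.strictMono_comap_of_surjective Ideal.Quotient.mk_surjective
  have hle := length_le_adim hX.2.1 (L.map _ hmono) fun i p hp => by
    change Ideal.Quotient.mk _ p ∈ (L i).asIdeal
    rw [Ideal.Quotient.eq_zero_iff_mem.2 hp]
    exact zero_mem _
  have hlen : (L.map _ hmono).length = s := hL.trans hl
  rwa [hlen] at hle

end AlgebraicSets


section ScalarExtension

variable {n : ℕ} (K : Type) [Field K] [Algebra ℂ K]

/-- Complex vectors regarded as vectors over an extension field. -/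
def constVec : (Fin n → ℂ) →ₗ[ℂ] (Fin n → K) := (Algebra.linearMap ℂ K).compLeft (Fin n)

/-- The scalar extension of a complex subspace. -/
def scalarExt (U : Submodule ℂ (Fin n → ℂ)) : Submodule K (Fin n → K) :=
  span K (constVec K '' U)

variable {K}

@[simp]
theorem constVec_apply (v : Fin n → ℂ) (i : Fin n) : constVec K v i = algebraMap ℂ K (v i) := rfl

theorem constVec_injective : Function.Injective (constVec K : (Fin n → ℂ) → (Fin n → K)) := by
  intro v w h
  ext i
  exact (algebraMap ℂ K).injective (congr_fun h i)

theorem constVec_ne_zero {v : Fin n → ℂ} (hv : v ≠ 0) : constVec K v ≠ 0 :=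
  (map_ne_zero_iff _ constVec_injective).2 hv

theorem constVec_smul (c : ℂ) (v : Fin n → ℂ) :
    constVec K (c • v) = algebraMap ℂ K c • constVec K v := by
  rw [map_smul, algebraMap_smul]

theorem constVec_mem {U : Submodule ℂ (Fin n → ℂ)} {v : Fin n → ℂ} (hv : v ∈ U) :
    constVec K v ∈ scalarExt K U :=
  subset_span ⟨v, hv, rfl⟩

theorem smul_constVec_mem {U : Submodule ℂ (Fin n → ℂ)} {v : Fin n → ℂ} (hv : v ∈ U) (c : K) :
    c • constVec K v ∈ scalarExt K U :=
  (scalarExt K U).smul_mem c (constVec_mem hv)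

theorem scalarExt_mono {U W : Submodule ℂ (Fin n → ℂ)} (h : U ≤ W) :
    scalarExt K U ≤ scalarExt K W :=
  span_mono (Set.image_mono h)

theorem disjoint_scalarExt {U W : Submodule ℂ (Fin n → ℂ)} (h : Disjoint U W) :
    Disjoint (scalarExt K U) (scalarExt K W) := by
  obtain ⟨U', hU', hc⟩ := h.exists_isCompl
  obtain ⟨M, hM⟩ : ∃ M : Matrix (Fin n) (Fin n) ℂ, ∀ v, M.mulVec v = U'.projection W hc v :=
    ⟨_, LinearMap.toMatrix'_mulVec (U'.projection W hc)⟩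
  let Q : (Fin n → K) →ₗ[K] (Fin n → K) := Matrix.mulVecLin (M.map (algebraMap ℂ K))
  have hQ : ∀ v, Q (constVec K v) = constVec K (U'.projection W hc v) := by
    intro v
    rw [← hM]
    ext i
    simp [Q, Matrix.mulVec, dotProduct]
  have h1 : ∀ y ∈ scalarExt K U, Q y = y := by
    intro y hy
    induction hy using span_induction with
    | mem y hy =>
      obtain ⟨v, hv, rfl⟩ := hy
      rw [hQ, projection_apply_of_mem_left hc (hU' hv)]
    | zero => simp
    | add y z _ _ hy hz => rw [map_add, hy, hz]
    | smul c y _ hy => rw [map_smul, hy]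
  have h2 : ∀ y ∈ scalarExt K W, Q y = 0 := by
    intro y hy
    induction hy using span_induction with
    | mem y hy =>
      obtain ⟨v, hv, rfl⟩ := hy
      rw [hQ, projection_apply_of_mem_right hc hv, map_zero]
    | zero => simp
    | add y z _ _ hy hz => rw [map_add, hy, hz, add_zero]
    | smul c y _ hy => rw [map_smul, hy, smul_zero]
  rw [Submodule.disjoint_def]
  intro y hy hy'
  rw [← h1 y hy, h2 y hy']

theorem eq_zero_of_smul_constVec_mem {U : Submodule ℂ (Fin n → ℂ)} {v : Fin n → ℂ} (hv : v ∉ U)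
    {c : K} (h : c • constVec K v ∈ scalarExt K U) : c = 0 := by
  have hd : Disjoint (span ℂ {v}) U := (disjoint_span_singleton_of_notMem hv).symm
  have h0 := (Submodule.disjoint_def.1 (disjoint_scalarExt (K := K) hd)) _
    (smul_constVec_mem (mem_span_singleton_self v) c) h
  refine (smul_eq_zero.1 h0).resolve_right (constVec_ne_zero ?_)
  rintro rfl
  exact hv U.zero_mem

end ScalarExtension

section ProjectionSystem

variable {n : ℕ} {K : Type} [Field K] [Algebra ℂ K]

/-- The Jacobian map sending a derivation to its values on a tuple of elements. -/
def jac (x : Fin n → K) : Derivation ℂ K K →ₗ[K] (Fin n → K) where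
  toFun D i := D (x i)
  map_add' _ _ := rfl
  map_smul' _ _ := rfl

theorem jac_apply (x : Fin n → K) (D : Derivation ℂ K K) (i : Fin n) : jac x D i = D (x i) := rfl

/-- The differential data on the function field of the affine cone of a surface `S` which is not
a cone but whose projections from the points of a dense subset `G` are: `x` is the generic point,
`E` the Euler derivation, and the projection from `A ∈ G` has a vertex in the direction `w A`,
giving rise to a derivation `D A` moving `x` in the plane spanned by `A` and `w A`. -/
structure ProjectionSystem (n : ℕ) (K : Type) [Field K] [Algebra ℂ K] where
  x : Fin n → K
  E : Derivation ℂ K K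
  G : Set (Fin n → ℂ)
  w : (Fin n → ℂ) → Fin n → ℂ
  D : (Fin n → ℂ) → Derivation ℂ K K
  g : (Fin n → ℂ) → K
  five_le : 5 ≤ n
  jac_injective : Function.Injective (jac x)
  finite : Module.Finite K (Derivation ℂ K K)
  finrank_le : Module.finrank K (Derivation ℂ K K) ≤ 3
  nondegenerate : ∀ U : Submodule ℂ (Fin n → ℂ), U ≠ ⊤ → x ∉ scalarExt K U
  eq_zero_of_jac_eq : ∀ (d : Derivation ℂ K K) (c : Fin n → ℂ), jac x d = constVec K c → c = 0
  jac_E : jac x E = x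
  ne_zero : ∀ A ∈ G, A ≠ 0
  jac_D : ∀ A ∈ G, jac x (D A) = constVec K (w A) + g A • constVec K A
  w_notMem : ∀ A ∈ G, w A ∉ span ℂ {A}
  exists_mem : ∀ U W : Submodule ℂ (Fin n → ℂ), U ≠ ⊤ → W ≠ ⊤ → ∃ A ∈ G, A ∉ U ∧ A ∉ W

namespace ProjectionSystem

variable (P : ProjectionSystem n K)

/-- The span of `A` and of the direction of the vertex of the projection from `A`. -/
def plane (A : Fin n → ℂ) : Submodule ℂ (Fin n → ℂ) := span ℂ {A, P.w A}

theorem mem_plane (A : Fin n → ℂ) : A ∈ P.plane A := subset_span (by simp)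

theorem w_mem_plane (A : Fin n → ℂ) : P.w A ∈ P.plane A := subset_span (by simp)

theorem finrank_plane_le (A : Fin n → ℂ) : Module.finrank ℂ (P.plane A) ≤ 2 := by
  classical
  refine (finrank_span_le_card _).trans ?_
  rw [Set.toFinset_insert, Set.toFinset_singleton]
  exact Finset.card_le_two

include P in
theorem ne_top_of_finrank_le {U : Submodule ℂ (Fin n → ℂ)} (h : Module.finrank ℂ U ≤ 4) :
    U ≠ ⊤ := by
  rintro rfl
  rw [finrank_top, Module.finrank_fin_fun] at h
  exact absurd P.five_le (by omega)

theorem finrank_sup_singleton_le (U : Submodule ℂ (Fin n → ℂ)) (v : Fin n → ℂ) :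
    Module.finrank ℂ (U ⊔ span ℂ {v} : Submodule ℂ (Fin n → ℂ)) ≤ Module.finrank ℂ U + 1 := by
  refine (finrank_add_le_finrank_add_finrank _ _).trans ?_
  gcongr
  exact (finrank_span_le_card _).trans (by simp)

theorem smul_x_mem {U : Submodule ℂ (Fin n → ℂ)} (hU : U ≠ ⊤) {a : K}
    (h : a • P.x ∈ scalarExt K U) : a = 0 := by
  by_contra ha
  exact P.nondegenerate U hU (((scalarExt K U).smul_mem_iff ha).1 h)

theorem eq_zero_of_jac_eq_smul {d : Derivation ℂ K K} {b : K} {c : Fin n → ℂ} (hc : c ≠ 0)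
    (h : jac P.x d = b • constVec K c) : b = 0 := by
  by_contra hb
  refine hc (P.eq_zero_of_jac_eq (b⁻¹ • d) c ?_)
  rw [map_smul, h, inv_smul_smul₀ hb]

theorem smul_w_add_smul_eq_zero {A : Fin n → ℂ} (hA : A ∈ P.G) {b c : K}
    (h : b • constVec K (P.w A) + c • constVec K A = 0) : b = 0 ∧ c = 0 := by
  have hb : b = 0 := by
    refine eq_zero_of_smul_constVec_mem (P.w_notMem A hA) ?_
    rw [eq_neg_of_add_eq_zero_left h]
    exact neg_mem (smul_constVec_mem (mem_span_singleton_self A) c)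
  refine ⟨hb, ?_⟩
  rw [hb, zero_smul, zero_add] at h
  exact (smul_eq_zero.1 h).resolve_right (constVec_ne_zero (P.ne_zero A hA))

theorem jac_D_mem {A : Fin n → ℂ} (hA : A ∈ P.G) : jac P.x (P.D A) ∈ scalarExt K (P.plane A) := by
  rw [P.jac_D A hA]
  exact add_mem (constVec_mem (P.w_mem_plane A)) (smul_constVec_mem (P.mem_plane A) _)

theorem jac_D_ne_zero {A : Fin n → ℂ} (hA : A ∈ P.G) : jac P.x (P.D A) ≠ 0 := by
  intro h
  rw [P.jac_D A hA] at h
  exact one_ne_zero (P.smul_w_add_smul_eq_zero hA (b := 1) (by rwa [one_smul])).1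

theorem exists_apply_g_ne_zero {A : Fin n → ℂ} (hA : A ∈ P.G) :
    ∃ d : Derivation ℂ K K, d (P.g A) ≠ 0 := by
  by_contra! h
  obtain ⟨c, hc⟩ := mem_range_of_forall_derivation_eq_zero _ h
  have h1 : jac P.x (P.D A) = constVec K (P.w A + c • A) := by
    rw [P.jac_D A hA, map_add, constVec_smul, hc]
  refine P.jac_D_ne_zero hA ?_
  rw [h1, P.eq_zero_of_jac_eq _ _ h1, map_zero]

theorem E_apply_g {A : Fin n → ℂ} (hA : A ∈ P.G) : P.E (P.g A) = 0 := by
  refine P.eq_zero_of_jac_eq_smul (d := ⁅P.E, P.D A⁆ + P.D A) (P.ne_zero A hA) ?_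
  ext i
  have h1 : P.D A (P.x i) = _ := congr_fun (P.jac_D A hA) i
  have h2 : P.E (P.x i) = P.x i := congr_fun P.jac_E i
  simp only [jac_apply, Derivation.add_apply, Derivation.commutator_apply, h2, h1]
  simp [Derivation.leibniz, mul_comm]

/-- A combination of the generic point and of vectors in two disjoint planes is trivial only if
every term vanishes. -/
theorem eq_zero_of_add_add_eq_zero {A B : Fin n → ℂ} (h : Disjoint (P.plane A) (P.plane B))
    {a : K} {y z : Fin n → K} (hy : y ∈ scalarExt K (P.plane A))
    (hz : z ∈ scalarExt K (P.plane B)) (h0 : a • P.x + y + z = 0) : a = 0 ∧ y = 0 ∧ z = 0 := by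
  have ha : a = 0 := by
    refine P.smul_x_mem (U := P.plane A ⊔ P.plane B) (P.ne_top_of_finrank_le ?_) ?_
    · have h1 := finrank_add_le_finrank_add_finrank (P.plane A) (P.plane B)
      have h2 := P.finrank_plane_le A
      have h3 := P.finrank_plane_le B
      omega
    · rw [add_assoc] at h0
      rw [eq_neg_of_add_eq_zero_left h0]
      exact neg_mem (add_mem (scalarExt_mono le_sup_left hy) (scalarExt_mono le_sup_right hz))
  rw [ha, zero_smul, zero_add] at h0
  have hy0 : y = 0 := by
    refine Submodule.disjoint_def.1 (disjoint_scalarExt h) y hy ?_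
    rw [eq_neg_of_add_eq_zero_left h0]
    exact neg_mem hz
  refine ⟨ha, hy0, ?_⟩
  rwa [hy0, zero_add] at h0

theorem eq_zero_of_smul_jac_D_eq_zero {A : Fin n → ℂ} (hA : A ∈ P.G) {b : K}
    (h : b • jac P.x (P.D A) = 0) : b = 0 :=
  (smul_eq_zero.1 h).resolve_right (P.jac_D_ne_zero hA)

theorem exists_eq_add_add {A B : Fin n → ℂ} (hA : A ∈ P.G) (hB : B ∈ P.G)
    (h : Disjoint (P.plane A) (P.plane B)) (d : Derivation ℂ K K) :
    ∃ a b c : K, d = a • P.E + b • P.D A + c • P.D B := by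
  have := P.finite
  have hli : LinearIndependent K ![P.E, P.D A, P.D B] := by
    rw [Fintype.linearIndependent_iff]
    intro f hf
    rw [Fin.sum_univ_three] at hf
    have h0 := congr_arg (jac P.x) hf
    simp only [Matrix.cons_val, map_add, map_smul, map_zero, P.jac_E] at h0
    obtain ⟨h1, h2, h3⟩ := P.eq_zero_of_add_add_eq_zero h (smul_mem _ _ (P.jac_D_mem hA))
      (smul_mem _ _ (P.jac_D_mem hB)) h0
    have h2' := P.eq_zero_of_smul_jac_D_eq_zero hA h2
    have h3' := P.eq_zero_of_smul_jac_D_eq_zero hB h3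
    intro i
    fin_cases i
    exacts [h1, h2', h3']
  have hcard : Fintype.card (Fin 3) = Module.finrank K (Derivation ℂ K K) := by
    refine le_antisymm hli.fintype_card_le_finrank ?_
    simpa using P.finrank_le
  have htop := hli.span_eq_top_of_card_eq_finrank' hcard
  have hd : d ∈ span K (Set.range ![P.E, P.D A, P.D B]) := htop ▸ mem_top
  obtain ⟨f, hf⟩ := (mem_span_range_iff_exists_fun K).1 hd
  rw [Fin.sum_univ_three] at hf
  exact ⟨f 0, f 1, f 2, hf.symm⟩

theorem D_apply_g {A B : Fin n → ℂ} (hA : A ∈ P.G) (hB : B ∈ P.G)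
    (h : Disjoint (P.plane A) (P.plane B)) : P.D B (P.g A) = 0 := by
  obtain ⟨a, b, c, habc⟩ := P.exists_eq_add_add hA hB h ⁅P.D A, P.D B⁆
  have h1 : jac P.x ⁅P.D A, P.D B⁆ =
      P.D A (P.g B) • constVec K B - P.D B (P.g A) • constVec K A := by
    ext i
    have h1 : P.D A (P.x i) = _ := congr_fun (P.jac_D A hA) i
    have h2 : P.D B (P.x i) = _ := congr_fun (P.jac_D B hB) i
    simp only [jac_apply, Derivation.commutator_apply, h2, h1]
    simp [Derivation.leibniz, mul_comm]
  have h2 := congr_arg (jac P.x) habc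
  simp only [h1, map_add, map_smul, P.jac_E] at h2
  have h3 := (P.eq_zero_of_add_add_eq_zero h (a := a)
    (y := b • jac P.x (P.D A) + P.D B (P.g A) • constVec K A)
    (z := c • jac P.x (P.D B) - P.D A (P.g B) • constVec K B)
    (add_mem (smul_mem _ _ (P.jac_D_mem hA)) (smul_constVec_mem (P.mem_plane A) _))
    (sub_mem (smul_mem _ _ (P.jac_D_mem hB)) (smul_constVec_mem (P.mem_plane B) _))
    (by linear_combination -h2)).2.1
  rw [P.jac_D A hA, smul_add, smul_smul, add_assoc, ← add_smul] at h3
  obtain ⟨hb, hc⟩ := P.smul_w_add_smul_eq_zero hA h3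
  rwa [hb, zero_mul, zero_add] at hc

theorem D_apply_g_self_ne_zero {A B : Fin n → ℂ} (hA : A ∈ P.G) (hB : B ∈ P.G)
    (h : Disjoint (P.plane A) (P.plane B)) : P.D A (P.g A) ≠ 0 := by
  obtain ⟨d, hd⟩ := P.exists_apply_g_ne_zero hA
  obtain ⟨a, b, c, rfl⟩ := P.exists_eq_add_add hA hB h d
  intro h0
  apply hd
  simp [P.E_apply_g hA, P.D_apply_g hA hB h, h0]

theorem not_pairwise_disjoint {A B C : Fin n → ℂ} (hA : A ∈ P.G) (hB : B ∈ P.G) (hC : C ∈ P.G)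
    (hAB : Disjoint (P.plane A) (P.plane B)) (hAC : Disjoint (P.plane A) (P.plane C))
    (hBC : Disjoint (P.plane B) (P.plane C)) : False := by
  obtain ⟨a, b, c, habc⟩ := P.exists_eq_add_add hA hB hAB (P.D C)
  have hb : b = 0 := by
    have h1 := P.D_apply_g hA hC hAC
    rw [habc] at h1
    simpa [P.E_apply_g hA, P.D_apply_g hA hB hAB, P.D_apply_g_self_ne_zero hA hB hAB] using h1
  have hc : c = 0 := by
    have h1 := P.D_apply_g hB hC hBC
    rw [habc] at h1
    simpa [P.E_apply_g hB, P.D_apply_g hB hA hAB.symm,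
      P.D_apply_g_self_ne_zero hB hA hAB.symm] using h1
  have h1 : jac P.x (P.D C) = a • P.x := by
    rw [habc, hb, hc, zero_smul, zero_smul, add_zero, add_zero, map_smul, P.jac_E]
  have ha : a = 0 := by
    refine P.smul_x_mem (U := P.plane C) (P.ne_top_of_finrank_le ?_) (h1 ▸ P.jac_D_mem hC)
    exact (P.finrank_plane_le C).trans (by norm_num)
  exact P.jac_D_ne_zero hC (by rw [h1, ha, zero_smul])

/-- If the planes of `A` and `C` meet and `C` is not in the plane of `A`, the vertex direction of
`C` is a vector of the plane of `A` modulo `C`. -/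
theorem exists_w_eq {A C : Fin n → ℂ} (hCA : C ∉ P.plane A)
    (h : ¬ Disjoint (P.plane A) (P.plane C)) :
    ∃ δ : ℂ, ∃ l ∈ P.plane A, P.w C = δ • C + l := by
  rw [Submodule.disjoint_def] at h
  push Not at h
  obtain ⟨z, hzA, hzC, hz⟩ := h
  obtain ⟨α, β, rfl⟩ := mem_span_pair.1 hzC
  have hβ : β ≠ 0 := by
    rintro rfl
    rw [zero_smul, add_zero] at hzA hz
    refine hCA (((P.plane A).smul_mem_iff ?_).1 hzA)
    rintro rfl
    exact hz (zero_smul _ _)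
  refine ⟨-(β⁻¹ * α), β⁻¹ • (α • C + β • P.w C), smul_mem _ _ hzA, ?_⟩
  rw [smul_add, inv_smul_smul₀ hβ, smul_smul]
  module

theorem jac_D_of_w_eq {C l : Fin n → ℂ} (hC : C ∈ P.G) {δ : ℂ} (hw : P.w C = δ • C + l) :
    ∃ h : K, h ≠ 0 ∧ jac P.x (P.D C) = constVec K l + h • constVec K C := by
  have h1 : jac P.x (P.D C) = constVec K l + (algebraMap ℂ K δ + P.g C) • constVec K C := by
    rw [P.jac_D C hC, hw, map_add, constVec_smul]
    module
  refine ⟨_, fun h0 => ?_, h1⟩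
  rw [h0, zero_smul, add_zero] at h1
  refine P.jac_D_ne_zero hC ?_
  rw [h1, P.eq_zero_of_jac_eq _ _ h1, map_zero]

theorem exists_smul_sub_sub_mem {A B C : Fin n → ℂ} (hA : A ∈ P.G) (hB : B ∈ P.G) (hC : C ∈ P.G)
    (hAB : Disjoint (P.plane A) (P.plane B)) (hCA : C ∉ P.plane A)
    (hAC : ¬ Disjoint (P.plane A) (P.plane C)) :
    ∃ h a c : K, h ≠ 0 ∧
      h • constVec K C - a • P.x - c • jac P.x (P.D B) ∈ scalarExt K (P.plane A) := by
  obtain ⟨δ, l, hl, hw⟩ := P.exists_w_eq hCA hAC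
  obtain ⟨h, hh, hD⟩ := P.jac_D_of_w_eq hC hw
  obtain ⟨a, b, c, habc⟩ := P.exists_eq_add_add hA hB hAB (P.D C)
  refine ⟨h, a, c, hh, ?_⟩
  have h1 := congr_arg (jac P.x) habc
  rw [hD, map_add, map_add, map_smul, map_smul, map_smul, P.jac_E] at h1
  have h2 : h • constVec K C - a • P.x - c • jac P.x (P.D B) =
      b • jac P.x (P.D A) - constVec K l := by
    linear_combination h1
  rw [h2]
  exact sub_mem (smul_mem _ _ (P.jac_D_mem hA)) (constVec_mem hl)

theorem mem_sup_of_not_disjoint {A B C C' : Fin n → ℂ} (hA : A ∈ P.G) (hB : B ∈ P.G)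
    (hAB : Disjoint (P.plane A) (P.plane B)) (hC : C ∈ P.G) (hCA : C ∉ P.plane A)
    (hAC : ¬ Disjoint (P.plane A) (P.plane C)) (hC' : C' ∈ P.G)
    (hAC' : ¬ Disjoint (P.plane A) (P.plane C')) : C' ∈ P.plane A ⊔ span ℂ {C} := by
  by_contra hCC'
  have hCA' : C' ∉ P.plane A := fun h => hCC' (le_sup_left (a := P.plane A) h)
  obtain ⟨h, a, c, hh, hm⟩ := P.exists_smul_sub_sub_mem hA hB hC hAB hCA hAC
  obtain ⟨h', a', c', hh', hm'⟩ := P.exists_smul_sub_sub_mem hA hB hC' hAB hCA' hAC'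
  have hU1 : Module.finrank ℂ (P.plane A ⊔ span ℂ {C} : Submodule ℂ (Fin n → ℂ)) ≤ 3 :=
    (finrank_sup_singleton_le _ _).trans (by have := P.finrank_plane_le A; omega)
  have hU2 : Module.finrank ℂ
      (P.plane A ⊔ span ℂ {C} ⊔ span ℂ {C'} : Submodule ℂ (Fin n → ℂ)) ≤ 4 :=
    (finrank_sup_singleton_le _ _).trans (by omega)
  have hCmem : C ∈ P.plane A ⊔ span ℂ {C} :=
    le_sup_right (a := P.plane A) (mem_span_singleton_self C)
  have hC'mem : C' ∈ P.plane A ⊔ span ℂ {C} ⊔ span ℂ {C'} :=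
    le_sup_right (a := P.plane A ⊔ span ℂ {C}) (mem_span_singleton_self C')
  have hm2 := sub_mem (smul_mem _ c' hm) (smul_mem _ c hm')
  have e1 : (c' * a - c * a') = 0 := by
    refine P.smul_x_mem (P.ne_top_of_finrank_le hU2) ?_
    have := sub_mem (sub_mem (smul_constVec_mem (le_sup_left (b := span ℂ {C'}) hCmem) (c' * h))
      (smul_constVec_mem hC'mem (c * h'))) (scalarExt_mono (le_sup_left.trans le_sup_left) hm2)
    convert this using 1
    module
  have e2 : c * h' = 0 := by
    refine eq_zero_of_smul_constVec_mem hCC' ?_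
    have := sub_mem (smul_constVec_mem hCmem (c' * h)) (scalarExt_mono le_sup_left hm2)
    convert this using 1
    have e1' : (c' * a - c * a') • P.x = 0 := by rw [e1, zero_smul]
    linear_combination (norm := module) -e1'
  have hc : c = 0 := (mul_eq_zero.1 e2).resolve_right hh'
  rw [hc, zero_smul, sub_zero] at hm
  have ha : a = 0 := by
    refine P.smul_x_mem (P.ne_top_of_finrank_le (hU1.trans (by norm_num))) ?_
    have := sub_mem (smul_constVec_mem hCmem h) (scalarExt_mono le_sup_left hm)
    convert this using 1
    module
  rw [ha, zero_smul, sub_zero] at hm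
  exact hh (eq_zero_of_smul_constVec_mem hCA hm)

theorem exists_forall_mem_or_disjoint {A B : Fin n → ℂ} (hA : A ∈ P.G) (hB : B ∈ P.G)
    (hAB : Disjoint (P.plane A) (P.plane B)) :
    ∃ U : Submodule ℂ (Fin n → ℂ), U ≠ ⊤ ∧
      ∀ C ∈ P.G, C ∉ U → Disjoint (P.plane A) (P.plane C) := by
  have h2 := P.finrank_plane_le A
  by_cases hex : ∃ C ∈ P.G, C ∉ P.plane A ∧ ¬ Disjoint (P.plane A) (P.plane C)
  · obtain ⟨C, hC, hCA, hAC⟩ := hex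
    refine ⟨P.plane A ⊔ span ℂ {C}, P.ne_top_of_finrank_le ?_, fun C' hC' hCC' => ?_⟩
    · exact (finrank_sup_singleton_le _ _).trans (by omega)
    · by_contra hAC'
      exact hCC' (P.mem_sup_of_not_disjoint hA hB hAB hC hCA hAC hC' hAC')
  · push Not at hex
    exact ⟨P.plane A, P.ne_top_of_finrank_le (by omega), hex⟩

theorem not_disjoint {A B : Fin n → ℂ} (hA : A ∈ P.G) (hB : B ∈ P.G) :
    ¬ Disjoint (P.plane A) (P.plane B) := by
  intro hAB
  obtain ⟨U, hU, hAU⟩ := P.exists_forall_mem_or_disjoint hA hB hAB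
  obtain ⟨W, hW, hBW⟩ := P.exists_forall_mem_or_disjoint hB hA hAB.symm
  obtain ⟨C, hC, hCU, hCW⟩ := P.exists_mem U W hU hW
  exact P.not_pairwise_disjoint hA hB hC hAB (hAU C hC hCU) (hBW C hC hCW)

/-- The planes attached to all the points share a direction. -/
theorem exists_common_direction :
    ∃ l : Fin n → ℂ, ∃ U : Submodule ℂ (Fin n → ℂ), U ≠ ⊤ ∧
      ∀ C ∈ P.G, C ∉ U → ∃ δ m : ℂ, P.w C = δ • C + m • l := by
  have hbot : (⊥ : Submodule ℂ (Fin n → ℂ)) ≠ ⊤ := P.ne_top_of_finrank_le (by simp)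
  obtain ⟨A, hA, -, -⟩ := P.exists_mem ⊥ ⊥ hbot hbot
  have h2 := P.finrank_plane_le A
  obtain ⟨B, hB, hBA, -⟩ := P.exists_mem (P.plane A) ⊥ (P.ne_top_of_finrank_le (by omega)) hbot
  obtain ⟨δ, l, hl, hw⟩ := P.exists_w_eq hBA (P.not_disjoint hA hB)
  have hBU : B ∈ P.plane A ⊔ span ℂ {B} :=
    le_sup_right (a := P.plane A) (mem_span_singleton_self B)
  have hle : P.plane B ≤ P.plane A ⊔ span ℂ {B} := by
    refine span_le.2 ?_
    rintro _ (rfl | rfl)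
    · exact hBU
    · rw [hw]
      exact add_mem (smul_mem _ _ hBU) (le_sup_left (a := P.plane A) hl)
  refine ⟨l, P.plane A ⊔ span ℂ {B}, P.ne_top_of_finrank_le ?_, fun C hC hCU => ?_⟩
  · exact (finrank_sup_singleton_le _ _).trans (by omega)
  obtain ⟨δ₁, l₁, hl₁, hw₁⟩ := P.exists_w_eq (fun h => hCU (le_sup_left (a := P.plane A) h))
    (P.not_disjoint hA hC)
  obtain ⟨δ₂, l₂, hl₂, hw₂⟩ := P.exists_w_eq (fun h => hCU (hle h)) (P.not_disjoint hB hC)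
  have hdiff : (δ₁ - δ₂) • C = l₂ - l₁ := by
    linear_combination (norm := module) hw₂ - hw₁
  have hδ : δ₁ - δ₂ = 0 := by
    by_contra hne
    refine hCU (((P.plane A ⊔ span ℂ {B}).smul_mem_iff hne).1 ?_)
    rw [hdiff]
    exact sub_mem (hle hl₂) (le_sup_left (a := P.plane A) hl₁)
  rw [hδ, zero_smul] at hdiff
  obtain rfl : l₂ = l₁ := sub_eq_zero.1 hdiff.symm
  obtain ⟨α, β, hαβ⟩ := mem_span_pair.1 hl₂
  rw [hw] at hαβ
  have hz : α + β * δ = 0 := by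
    by_contra hne
    refine hBA (((P.plane A).smul_mem_iff hne).1 ?_)
    have h3 : (α + β * δ) • B = l₂ - β • l := by
      rw [← hαβ]
      module
    rw [h3]
    exact sub_mem hl₁ (smul_mem _ _ hl)
  refine ⟨δ₁, β, ?_⟩
  rw [hw₁, ← hαβ]
  have hz' : (α + β * δ) • B = 0 := by rw [hz, zero_smul]
  linear_combination (norm := module) hz'

include P in
/-- There is no such system. -/
theorem isFalse : False := by
  have := P.finite
  obtain ⟨l, U, hU, hUl⟩ := P.exists_common_direction
  let T : Submodule K (Fin n → K) := LinearMap.range (jac P.x) ⊔ span K {constVec K l}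
  let W : Submodule ℂ (Fin n → ℂ) := (T.restrictScalars ℂ).comap (constVec K)
  have hW : W = ⊤ := by
    by_contra hW
    obtain ⟨C, hC, hCU, hCW⟩ := P.exists_mem U W hU hW
    obtain ⟨δ, m, hw⟩ := hUl C hC hCU
    obtain ⟨h, hh, hD⟩ := P.jac_D_of_w_eq hC hw
    apply hCW
    change constVec K C ∈ T
    refine (T.smul_mem_iff hh).1 ?_
    have h1 : h • constVec K C = jac P.x (P.D C) - algebraMap ℂ K m • constVec K l := by
      rw [hD, constVec_smul]
      module
    rw [h1]
    exact sub_mem (le_sup_left (a := LinearMap.range (jac P.x)) ⟨_, rfl⟩)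
      (smul_mem _ _ (le_sup_right (a := LinearMap.range (jac P.x)) (mem_span_singleton_self _)))
  have hT : T = ⊤ := by
    rw [eq_top_iff, ← (Pi.basisFun K (Fin n)).span_eq, span_le]
    rintro _ ⟨i, rfl⟩
    have hi : (Pi.single i 1 : Fin n → ℂ) ∈ W := hW ▸ mem_top
    have he : Pi.basisFun K (Fin n) i = constVec K (Pi.single i 1) := by
      ext j
      simp [Pi.single_apply, apply_ite]
    rw [he]
    exact hi
  have h1 : Module.finrank K T = n := by rw [hT, finrank_top, Module.finrank_fin_fun]
  have h2 : Module.finrank K T ≤ Module.finrank K (LinearMap.range (jac P.x)) +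
      Module.finrank K (span K {constVec K l}) := finrank_add_le_finrank_add_finrank _ _
  have h3 : Module.finrank K (span K {constVec K l}) ≤ 1 :=
    (finrank_span_le_card _).trans (by simp)
  have h4 := LinearMap.finrank_range_le (jac P.x)
  have h5 := P.finrank_le
  have h6 := P.five_le
  omega

end ProjectionSystem

end ProjectionSystem

section GenericPoint

open MvPolynomial

variable {n : ℕ}

/-- The function field of an irreducible algebraic set, with its generic point. -/
theorem exists_genericPoint {S : Set (Fin n → ℂ)} (hS : IsIrrAlg S) :
    ∃ (K : Type) (_ : Field K) (_ : Algebra ℂ K) (x : Fin n → K),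
      (∀ p : MvPolynomial (Fin n) ℂ, aeval x p = 0 ↔ ∀ s ∈ S, eval s p = 0) ∧
      Function.Injective (jac x) ∧ Module.Finite K (Derivation ℂ K K) ∧
      (Module.finrank K (Derivation ℂ K K) : ℕ∞) ≤ adim S := by
  have hprime := hS.isPrime_vanishingIdeal
  let R := MvPolynomial (Fin n) ℂ ⧸ vanishingIdeal ℂ S
  let K := FractionRing R
  let x : Fin n → K := fun i => algebraMap R K (Ideal.Quotient.mk _ (X i))
  have hx : ∀ p : MvPolynomial (Fin n) ℂ, aeval x p = algebraMap R K (Ideal.Quotient.mk _ p) := by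
    intro p
    have h : aeval x = ((IsScalarTower.toAlgHom ℂ R K).comp
        (Ideal.Quotient.mkₐ ℂ (vanishingIdeal ℂ S))) := by
      ext i
      simp [x, R]
    rw [h]
    rfl
  refine ⟨K, inferInstance, inferInstance, x, fun p => ?_, ?_, ?_⟩
  · rw [hx, map_eq_zero_iff _ (IsFractionRing.injective R K), Ideal.Quotient.eq_zero_iff_mem,
      mem_vanishingIdeal_iff]
    simp only [aeval_eq_eval]
  · rw [injective_iff_map_eq_zero]
    intro D hD
    have hR : ∀ r : R, D (algebraMap R K r) = 0 := by
      intro r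
      obtain ⟨p, rfl⟩ := Ideal.Quotient.mk_surjective r
      rw [← hx]
      induction p using MvPolynomial.induction_on with
      | C a => rw [aeval_C, D.map_algebraMap]
      | add p q hp hq => rw [map_add, map_add, hp, hq, add_zero]
      | mul_X p j hp =>
        have hj : D (x j) = 0 := congr_fun hD j
        rw [map_mul, D.leibniz, hp, aeval_X, hj]
        simp
    ext z
    obtain ⟨a, b, -, rfl⟩ := IsFractionRing.div_surjective (A := R) z
    rw [D.leibniz_div, hR, hR]
    simp
  · obtain ⟨s, g, hg, hs⟩ := exists_integral_le_adim hS
    obtain ⟨h1, h2⟩ := finrank_derivation_le (R := R) (K := K) g hg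
    exact ⟨h1, le_trans (by exact_mod_cast h2) hs⟩

theorem exists_eval_ne_zero {S : Set (Fin n → ℂ)} (hnd : Nondeg S)
    {U : Submodule ℂ (Fin n → ℂ)} (hU : U ≠ ⊤) :
    ∃ a : Fin n → ℂ, (∀ u ∈ U, ∑ i, a i * u i = 0) ∧ ∃ s ∈ S, ∑ i, a i * s i ≠ 0 := by
  obtain ⟨f, hf, hfU⟩ := U.exists_le_ker_of_lt_top hU.lt_top
  have hfa : ∀ z, f z = ∑ i, f (Pi.single i 1) * z i := by
    intro z
    simpa using exists_mvPolynomial_of_isLinearMap f.isLinear z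
  refine ⟨fun i => f (Pi.single i 1), fun u hu => ?_, ?_⟩
  · rw [← hfa]
    exact hfU hu
  · by_contra! h
    apply hf
    rw [← LinearMap.ker_eq_top, eq_top_iff, ← show span ℂ S = ⊤ from hnd, span_le]
    intro s hs
    exact (hfa s).trans (h s hs)

variable {K : Type} [Field K] [Algebra ℂ K] {S : Set (Fin n → ℂ)} {x : Fin n → K}

theorem notMem_scalarExt
    (hx : ∀ p : MvPolynomial (Fin n) ℂ, aeval x p = 0 ↔ ∀ s ∈ S, eval s p = 0)
    (hnd : Nondeg S) {U : Submodule ℂ (Fin n → ℂ)} (hU : U ≠ ⊤) : x ∉ scalarExt K U := by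
  obtain ⟨a, ha, s, hs, has⟩ := exists_eval_ne_zero hnd hU
  intro hmem
  have h0 : ∑ i, algebraMap ℂ K (a i) * x i = 0 := by
    clear hx
    induction hmem using span_induction with
    | mem y hy =>
      obtain ⟨u, hu, rfl⟩ := hy
      simp only [constVec_apply, ← map_mul, ← map_sum, ha u hu, map_zero]
    | zero => simp
    | add y z _ _ hy hz =>
      simp only [Pi.add_apply, mul_add, Finset.sum_add_distrib, hy, hz, add_zero]
    | smul c y _ hy =>
      simp only [Pi.smul_apply, smul_eq_mul, mul_left_comm _ c, ← Finset.mul_sum, hy, mul_zero]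
  have h1 := (hx (∑ i, C (a i) * X i)).1 (by simpa using h0) s hs
  exact has (by simpa using h1)

/-- Infinitesimal form of a family of motions `s ↦ s + t • q s` which preserves the vanishing on
`S` of the polynomials of a subalgebra `Q`. -/
theorem exists_derivation_of_motion
    (hx : ∀ p : MvPolynomial (Fin n) ℂ, aeval x p = 0 ↔ ∀ s ∈ S, eval s p = 0)
    (Q : Subalgebra ℂ (MvPolynomial (Fin n) ℂ)) (q : Fin n → MvPolynomial (Fin n) ℂ)
    (hQ : ∀ f ∈ Q, (∀ s ∈ S, eval s f = 0) →
      ∀ t : ℂ, ∀ s ∈ S, eval (fun i => s i + t * eval s (q i)) f = 0) :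
    ∃ D : Derivation ℂ K K, ∀ a : Fin n → ℂ, ∑ i, C (a i) * X i ∈ Q →
      ∑ i, algebraMap ℂ K (a i) * D (x i) = ∑ i, algebraMap ℂ K (a i) * aeval x (q i) := by
  obtain ⟨y, hy⟩ : ∃ y : Fin n → K, ∀ i, aeval x (q i) = y i := ⟨_, fun _ => rfl⟩
  let Ψ : MvPolynomial (Fin n) ℂ →ₐ[ℂ] TrivSqZeroExt K K :=
    aeval fun i => TrivSqZeroExt.inl (x i) + TrivSqZeroExt.inr (y i)
  have hline : ∀ f ∈ Q, aeval x f = 0 → Ψ f = 0 := by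
    intro f hf h0
    have hF : aeval (fun i => Polynomial.C (x i) + Polynomial.C (y i) * Polynomial.X) f =
        (0 : Polynomial K) := by
      refine Polynomial.eq_zero_of_infinite_isRoot _ (Set.Infinite.mono ?_
        (Set.infinite_range_of_injective (algebraMap ℂ K).injective))
      rintro _ ⟨t, rfl⟩
      have h1 := (hx (bind₁ (fun i => X i + q i * C t) f)).2 fun s hs => by
        have h2 := hQ f hf ((hx f).1 h0) t s hs
        rw [← aeval_eq_eval, aeval_bind₁]
        simpa [aeval_eq_eval, mul_comm t] using h2
      rw [aeval_bind₁] at h1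
      change Polynomial.eval _ _ = 0
      rw [← Polynomial.coe_aeval_eq_eval]
      change ((Polynomial.aeval (algebraMap ℂ K t)).restrictScalars ℂ : Polynomial K →ₐ[ℂ] K) _ = 0
      rw [comp_aeval_apply]
      simpa [hy] using h1
    have h4 := congr_arg ((Polynomial.aeval (TrivSqZeroExt.inr (1 : K) :
      TrivSqZeroExt K K)).restrictScalars ℂ : Polynomial K →ₐ[ℂ] TrivSqZeroExt K K) hF
    rw [comp_aeval_apply, map_zero] at h4
    rw [← h4]
    change aeval _ f = aeval _ f
    congr 2
    ext i <;> simp [TrivSqZeroExt.algebraMap_eq_inl]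
  obtain ⟨D, hD⟩ := exists_derivation_extending ((aeval x).comp Q.val) (Ψ.comp Q.val)
    (fun p => by
      change TrivSqZeroExt.fstHom ℂ K K (Ψ _) = _
      simp only [Ψ]
      rw [comp_aeval_apply]
      simp)
    (fun p hp => hline p p.2 hp)
  refine ⟨D, fun a ha => ?_⟩
  have h := hD ⟨_, ha⟩
  simpa [Ψ, hy, TrivSqZeroExt.snd_sum, ← Algebra.smul_def] using h

theorem exists_euler (hS : IsCone S)
    (hx : ∀ p : MvPolynomial (Fin n) ℂ, aeval x p = 0 ↔ ∀ s ∈ S, eval s p = 0) :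
    ∃ E : Derivation ℂ K K, jac x E = x := by
  obtain ⟨E, hE⟩ := exists_derivation_of_motion hx ⊤ X fun f _ hf t s hs => by
    have h := hf _ (hS.2 (1 + t) s hs)
    convert h using 2
    refine congr_arg eval ?_
    ext i
    simp only [eval_X, Pi.smul_apply, smul_eq_mul]
    ring
  refine ⟨E, ?_⟩
  ext i
  rw [jac_apply]
  simpa [Pi.single_apply, apply_ite] using hE (Pi.single i 1) trivial

/-- The derivation attached to a vertex of the projection of `S` from the point `A`. -/
theorem exists_derivation_of_isConeVar_projection
    (hx : ∀ p : MvPolynomial (Fin n) ℂ, aeval x p = 0 ↔ ∀ s ∈ S, eval s p = 0)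
    {A : Fin n → ℂ} (hA : A ≠ 0) (hcone : IsConeVar (zcl ((span ℂ {A}).mkQ '' S))) :
    ∃ (w : Fin n → ℂ) (D : Derivation ℂ K K) (g : K), w ∉ span ℂ {A} ∧
      jac x D = constVec K w + g • constVec K A := by
  obtain ⟨v, -, hv, hY⟩ := hcone
  obtain ⟨w, rfl⟩ := mkQ_surjective _ v
  have hw : w ∉ span ℂ {A} := fun h => hv ((Quotient.mk_eq_zero _).2 h)
  let Q : Subalgebra ℂ (MvPolynomial (Fin n) ℂ) :=
    { carrier := {f | ∃ F ∈ PolyFun ((Fin n → ℂ) ⧸ span ℂ {A}),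
        ∀ z, eval z f = F ((span ℂ {A}).mkQ z)}
      mul_mem' := by
        rintro f f' ⟨F, hF, h⟩ ⟨F', hF', h'⟩
        exact ⟨F * F', mul_mem hF hF', fun z => by simp [h, h']⟩
      add_mem' := by
        rintro f f' ⟨F, hF, h⟩ ⟨F', hF', h'⟩
        exact ⟨F + F', add_mem hF hF', fun z => by simp [h, h']⟩
      algebraMap_mem' := fun c => ⟨_, Subalgebra.algebraMap_mem _ c, fun z => by simp⟩ }
  obtain ⟨D, hD⟩ := exists_derivation_of_motion hx Q (fun i => C (w i)) fun f hf h0 t s hs => by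
    obtain ⟨F, hF, hfF⟩ := hf
    have hvan : zcl ((span ℂ {A}).mkQ '' S) ⊆ {u | F u = 0} := by
      refine Set.sInter_subset_of_mem ⟨⟨{F}, by simpa using hF, by simp⟩, ?_⟩
      rintro _ ⟨s, hs, rfl⟩
      exact (hfF s).symm.trans (h0 s hs)
    have hsY : (span ℂ {A}).mkQ s ∈ zcl ((span ℂ {A}).mkQ '' S) :=
      Set.mem_sInter.2 fun Y hY => hY.2 ⟨s, hs, rfl⟩
    have h1 := hvan (hY _ hsY t 1)
    rw [Set.mem_ofPred_eq, one_smul, ← map_smul, ← map_add, ← hfF] at h1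
    convert h1 using 2
    refine congr_arg eval ?_
    ext i
    simp [add_comm]
  obtain ⟨j, hj⟩ := Function.ne_iff.1 hA
  have hj' : algebraMap ℂ K (A j) ≠ 0 := (map_ne_zero _).2 hj
  refine ⟨w, D, (D (x j) - algebraMap ℂ K (w j)) / algebraMap ℂ K (A j), hw, ?_⟩
  ext i
  have hmem : ∑ k, C ((A j • Pi.single i 1 - A i • Pi.single j 1 : Fin n → ℂ) k) * X k ∈ Q := by
    let f : (Fin n → ℂ) →ₗ[ℂ] ℂ := A j • LinearMap.proj i - A i • LinearMap.proj j
    have hker : span ℂ {A} ≤ LinearMap.ker f := by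
      rw [span_singleton_le_iff_mem]
      simp [f, mul_comm]
    refine ⟨(span ℂ {A}).liftQ f hker, Algebra.subset_adjoin (LinearMap.isLinear _), fun z => ?_⟩
    simp [f, Pi.single_apply, sub_mul, Finset.sum_sub_distrib]
  have h := hD _ hmem
  simp only [Pi.sub_apply, Pi.smul_apply, smul_eq_mul, map_sub, sub_mul,
    Finset.sum_sub_distrib, aeval_C, Pi.single_apply, apply_ite (algebraMap ℂ K), map_zero,
    mul_ite, ite_mul, mul_one, mul_zero, zero_mul, Finset.sum_ite_eq', Finset.mem_univ,
    if_true] at h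
  simp only [jac_apply, Pi.add_apply, Pi.smul_apply, constVec_apply, smul_eq_mul]
  field_simp
  linear_combination h

/-- A derivation with constant values on the generic point is a direction of translations
preserving `S`. -/
theorem add_smul_mem_of_jac_eq (hS : IsAlgSet S)
    (hx : ∀ p : MvPolynomial (Fin n) ℂ, aeval x p = 0 ↔ ∀ s ∈ S, eval s p = 0)
    {d : Derivation ℂ K K} {c : Fin n → ℂ} (hd : jac x d = constVec K c) {s : Fin n → ℂ}
    (hs : s ∈ S) (t : ℂ) : s + t • c ∈ S := by
  let δ : Derivation ℂ (MvPolynomial (Fin n) ℂ) (MvPolynomial (Fin n) ℂ) :=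
    mkDerivation ℂ fun i => C (c i)
  have hδ : ∀ f, aeval x (δ f) = d (aeval x f) := by
    intro f
    induction f using MvPolynomial.induction_on with
    | C a => simp [δ]
    | add p q hp hq => simp only [map_add, hp, hq]
    | mul_X p j hp =>
      have hj : d (x j) = algebraMap ℂ K (c j) := congr_fun hd j
      simp only [δ] at hp
      simp [δ, Derivation.leibniz, hj, hp]
  let L : MvPolynomial (Fin n) ℂ →ₐ[ℂ] Polynomial ℂ :=
    aeval fun i => Polynomial.C (s i) + Polynomial.X * Polynomial.C (c i)
  have hL : ∀ f, Polynomial.derivative (L f) = L (δ f) := by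
    intro f
    induction f using MvPolynomial.induction_on with
    | C a => simp [δ, L]
    | add p q hp hq => simp only [map_add, hp, hq]
    | mul_X p j hp =>
      rw [map_mul, Polynomial.derivative_mul, hp]
      simp [δ, L, Derivation.leibniz]
      ring
  have heval : ∀ f (r : ℂ), Polynomial.eval r (L f) = eval (s + r • c) f := by
    intro f r
    rw [← Polynomial.coe_aeval_eq_eval, ← aeval_eq_eval]
    change Polynomial.aeval r (L f) = _
    simp only [L]
    rw [comp_aeval_apply]
    congr 2
    ext i
    simp
    exact mul_comm _ _
  have hcoeff : ∀ (k : ℕ) (f : MvPolynomial (Fin n) ℂ), aeval x f = 0 → (L f).coeff k = 0 := by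
    intro k
    induction k with
    | zero =>
      intro f hf
      rw [Polynomial.coeff_zero_eq_eval_zero, heval, zero_smul, add_zero]
      exact (hx f).1 hf s hs
    | succ k ih =>
      intro f hf
      have h := ih (δ f) (by rw [hδ, hf, map_zero])
      rw [← hL, Polynomial.coeff_derivative] at h
      exact (mul_eq_zero.1 h).resolve_right (Nat.cast_add_one_ne_zero k)
  rw [← hS.zeroLocus_vanishingIdeal]
  intro f hf
  have h0 : L f = 0 := by
    ext k
    refine hcoeff k f ((hx f).2 fun s hs => ?_)
    rw [← aeval_eq_eval]
    exact hf s hs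
  rw [aeval_eq_eval]
  change eval _ f = 0
  rw [← heval, h0, Polynomial.eval_zero]

theorem eq_zero_of_jac_eq_constVec (hS : IsProjVar S) (hcone : ¬ IsConeVar S)
    (hx : ∀ p : MvPolynomial (Fin n) ℂ, aeval x p = 0 ↔ ∀ s ∈ S, eval s p = 0)
    (d : Derivation ℂ K K) (c : Fin n → ℂ) (hd : jac x d = constVec K c) : c = 0 := by
  by_contra hc
  have h := fun s hs t => add_smul_mem_of_jac_eq hS.1 hx hd (s := s) hs t
  refine hcone ⟨c, ?_, hc, fun s hs a b => ?_⟩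
  · simpa using h 0 hS.2.1.1 1
  · rw [add_comm]
    exact h _ (hS.2.1.2 b s hs) a

/-- A general point of a nondegenerate variety lies neither in a given proper closed subset nor in
given proper subspaces. -/
theorem exists_mem_notMem (hS : IsIrrAlg S) (hnd : Nondeg S) {Z : Set (Fin n → ℂ)}
    (hZ : IsAlgSet Z) (hSZ : ¬ S ⊆ Z) {U W : Submodule ℂ (Fin n → ℂ)} (hU : U ≠ ⊤)
    (hW : W ≠ ⊤) : ∃ A ∈ S, A ∉ Z ∧ A ∉ U ∧ A ∉ W := by
  have hprime := hS.isPrime_vanishingIdeal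
  rw [← hZ.zeroLocus_vanishingIdeal, Set.not_subset] at hSZ
  obtain ⟨z, hz, hzZ⟩ := hSZ
  simp only [mem_zeroLocus_iff, not_forall] at hzZ
  obtain ⟨p, hp, hpz⟩ := hzZ
  obtain ⟨a, ha, s, hs, has⟩ := exists_eval_ne_zero hnd hU
  obtain ⟨b, hb, r, hr, hbr⟩ := exists_eval_ne_zero hnd hW
  have h1 : p ∉ vanishingIdeal ℂ S := fun h => hpz (h z hz)
  have h2 : (∑ i, C (a i) * X i : MvPolynomial (Fin n) ℂ) ∉ vanishingIdeal ℂ S := fun h =>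
    has (by simpa [aeval_eq_eval] using h s hs)
  have h3 : (∑ i, C (b i) * X i : MvPolynomial (Fin n) ℂ) ∉ vanishingIdeal ℂ S := fun h =>
    hbr (by simpa [aeval_eq_eval] using h r hr)
  have h4 := hprime.mul_notMem (hprime.mul_notMem h1 h2) h3
  simp only [mem_vanishingIdeal_iff, not_forall] at h4
  obtain ⟨A, hA, hne⟩ := h4
  rw [map_mul, map_mul, ← ne_eq, mul_ne_zero_iff, mul_ne_zero_iff] at hne
  refine ⟨A, hA, fun h => hne.1.1 (hp A h), fun h => hne.1.2 ?_, fun h => hne.2 ?_⟩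
  · simpa [aeval_eq_eval] using ha A h
  · simpa [aeval_eq_eval] using hb A h

end GenericPoint

/-- If the projection of an integral non-degenerate surface `S ⊂ P^N`, `N ≥ 4`, from a
general point `A ∈ S` is a cone, then `S` itself is a cone. Projection from `A` is
modelled by the quotient map modulo the line `ℂ·A`. -/
theorem cone_of_general_projection_cone (N : ℕ) (hN : 4 ≤ N)
    (S : Set (Fin (N + 1) → ℂ)) (hS : IsProjVar S) (hnd : Nondeg S)
    (hdim : pdim S = 2)
    (hproj : ∃ Z : Set (Fin (N + 1) → ℂ), IsAlgSet Z ∧ ¬ (S ⊆ Z) ∧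
      ∀ A ∈ S, A ∉ Z → A ≠ 0 →
        IsConeVar (zcl ((Submodule.span ℂ {A}).mkQ '' S))) :
    IsConeVar S := by
  by_contra hcone
  obtain ⟨Z, hZ, hSZ, hproj⟩ := hproj
  obtain ⟨K, _, _, x, hx, hinj, hfin, hrank⟩ := exists_genericPoint hS.2.2.1
  have hadim : adim S ≤ 2 + 1 := tsub_le_iff_right.1 (le_of_eq hdim)
  obtain ⟨E, hE⟩ := exists_euler hS.2.1 hx
  have hvertex : ∀ A, A ∈ {A | A ∈ S ∧ A ∉ Z ∧ A ≠ 0} →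
      ∃ (w : Fin (N + 1) → ℂ) (D : Derivation ℂ K K) (g : K), w ∉ span ℂ {A} ∧
        jac x D = constVec K w + g • constVec K A := fun A hA =>
    exists_derivation_of_isConeVar_projection hx hA.2.2 (hproj A hA.1 hA.2.1 hA.2.2)
  choose! w D g hw hD using hvertex
  exact ProjectionSystem.isFalse
    { x := x
      E := E
      G := {A | A ∈ S ∧ A ∉ Z ∧ A ≠ 0}
      w := w
      D := D
      g := g
      five_le := by omega
      jac_injective := hinj
      finite := hfin
      finrank_le := by
        have h : (Module.finrank K (Derivation ℂ K K) : ℕ∞) ≤ ((3 : ℕ) : ℕ∞) :=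
          (hrank.trans hadim).trans (by norm_num)
        exact_mod_cast h
      nondegenerate := fun U hU => notMem_scalarExt hx hnd hU
      eq_zero_of_jac_eq := eq_zero_of_jac_eq_constVec hS hcone hx
      jac_E := hE
      ne_zero := fun A hA => hA.2.2
      jac_D := hD
      w_notMem := hw
      exists_mem := fun U W hU hW => by
        obtain ⟨A, hA, hAZ, hAU, hAW⟩ := exists_mem_notMem hS.2.2.1 hnd hZ hSZ hU hW
        refine ⟨A, ⟨hA, hAZ, ?_⟩, hAU, hAW⟩
        rintro rfl
        exact hAU U.zero_mem }
end
end

section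
/- Let Q ⊂ P^3 be a smooth quadric surface and embed Q into P^5 by the complete linear system of divisors of type (2,1). Then through any three general points of the image surface S there passes a rational normal cubic curve contained in S (the image of the unique (1,1)-conic on Q through the three corresponding points), spanning a P^3; consequently every line in the plane spanned by the three points lies in infinitely many 3-secant planes to S, so dim G_{1,2}(S) < 8. -/
open Submodule

noncomputable section

/-- Plücker points of the spans of `(k+1)`-tuples of points of `X`: the raw affine cone
over the image of the span map `Φ : X^{k+1} ⇢ G(k,r)` in Plücker coordinates. -/
def GkConePre {W : Type*} [AddCommGroup W] [Module ℂ W] (X : Set W) (k : ℕ) :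
    Set (ExteriorAlgebra ℂ W) :=
  {w | ∃ p : Fin (k + 1) → W, (∀ i, p i ∈ X) ∧ w = ExteriorAlgebra.ιMulti ℂ (k + 1) p}

/-- Affine cone over `G_k(X)` (in Plücker coordinates): Zariski closure of the cone over
the image of the span map. -/
def GkCone {W : Type*} [AddCommGroup W] [Module ℂ W] (X : Set W) (k : ℕ) :
    Set (ExteriorAlgebra ℂ W) :=
  zcl (GkConePre X k)

/-- `G_k(X)` as a set of `(k+1)`-dimensional subspaces (projective `k`-planes): those
whose Plücker point lies in the closure of the image of the span map. -/
def Gk {W : Type*} [AddCommGroup W] [Module ℂ W] (X : Set W) (k : ℕ) :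
    Set (Submodule ℂ W) :=
  {U | Module.finrank ℂ U = k + 1 ∧
    ∀ p : Fin (k + 1) → W, (∀ i, p i ∈ U) →
      ExteriorAlgebra.ιMulti ℂ (k + 1) p ∈ GkCone X k}

/-- Raw cone of Plücker points of `h`-planes contained in some `(k+1)`-secant `k`-plane. -/
def GhkConePre {W : Type*} [AddCommGroup W] [Module ℂ W] (X : Set W) (h k : ℕ) :
    Set (ExteriorAlgebra ℂ W) :=
  {w | ∃ (p : Fin (k + 1) → W) (q : Fin (h + 1) → W), (∀ i, p i ∈ X) ∧
    (∀ j, q j ∈ Submodule.span ℂ (Set.range p)) ∧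
    w = ExteriorAlgebra.ιMulti ℂ (h + 1) q}

/-- Affine cone over `G_{h,k}(X)` in Plücker coordinates. -/
def GhkCone {W : Type*} [AddCommGroup W] [Module ℂ W] (X : Set W) (h k : ℕ) :
    Set (ExteriorAlgebra ℂ W) :=
  zcl (GhkConePre X h k)


/-- The affine cone over the image of the smooth quadric `P^1 × P^1` embedded in `P^5`
by the complete linear system of divisors of type `(2,1)`. -/
def Scroll21 : Set (Fin 6 → ℂ) :=
  zcl (Set.range fun x : (ℂ × ℂ) × (ℂ × ℂ) =>
    ![x.2.1 * x.1.1 ^ 2, x.2.2 * x.1.1 ^ 2, x.2.1 * x.1.1 * x.1.2,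
      x.2.2 * x.1.1 * x.1.2, x.2.1 * x.1.2 ^ 2, x.2.2 * x.1.2 ^ 2])

section Zariski

variable {U W : Type*} [AddCommGroup U] [Module ℂ U] [AddCommGroup W] [Module ℂ W]

theorem linear_mem_polyFun (l : W →ₗ[ℂ] ℂ) : (fun x => l x) ∈ PolyFun W :=
  Algebra.subset_adjoin ⟨l.map_add, l.map_smul⟩

theorem const_mem_polyFun (c : ℂ) : (fun _ => c) ∈ PolyFun W :=
  (PolyFun W).algebraMap_mem c

theorem isAlgSet_zero {f : W → ℂ} (hf : f ∈ PolyFun W) : IsAlgSet {x | f x = 0} :=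
  ⟨{f}, by simpa using hf, by simp⟩

theorem isAlgSet_submodule (V : Submodule ℂ W) : IsAlgSet (V : Set W) := by
  refine ⟨{f | f ∈ PolyFun W ∧ ∀ x ∈ V, f x = 0}, fun f hf => hf.1, ?_⟩
  ext x
  refine ⟨fun hx f hf => hf.2 x hx, fun hx => ?_⟩
  by_contra hxV
  obtain ⟨l, hl, hV⟩ := V.exists_le_ker_of_notMem hxV
  exact hl (hx _ ⟨linear_mem_polyFun l, fun y hy => hV hy⟩)

theorem subset_zcl (A : Set W) : A ⊆ zcl A := fun _ hx _ hY => hY.2 hx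

theorem zcl_subset {A Y : Set W} (hY : IsAlgSet Y) (h : A ⊆ Y) : zcl A ⊆ Y :=
  fun _ hx => hx Y ⟨hY, h⟩

theorem eq_zero_of_mem_zcl {A : Set W} {f : W → ℂ} (hf : f ∈ PolyFun W)
    (h : ∀ x ∈ A, f x = 0) {x : W} (hx : x ∈ zcl A) : f x = 0 :=
  zcl_subset (isAlgSet_zero hf) h hx

theorem mem_zcl_of_forall {A : Set W} {x : W}
    (h : ∀ f ∈ PolyFun W, (∀ y ∈ A, f y = 0) → f x = 0) : x ∈ zcl A := by
  rintro Y ⟨⟨S, hS, rfl⟩, hA⟩ f hf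
  exact h f (hS hf) fun y hy => hA hy f hf

theorem zcl_subset_zcl {A B : Set W} (h : A ⊆ zcl B) : zcl A ⊆ zcl B :=
  fun _ hx Y hY => hx Y ⟨hY.1, fun _ ha => h ha Y hY⟩

/-- Polynomial maps: finite sums of polynomial functions times constant vectors. -/
def IsPolyMap (F : U → W) : Prop :=
  ∃ (κ : Type) (_ : Fintype κ) (g : κ → U → ℂ) (w : κ → W),
    (∀ k, g k ∈ PolyFun U) ∧ ∀ x, F x = ∑ k, g k x • w k

/-- Precomposition with a map, as an algebra homomorphism of algebras of functions. -/
def pullback (F : U → W) : (W → ℂ) →ₐ[ℂ] (U → ℂ) where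
  toFun f := f ∘ F
  map_one' := rfl
  map_mul' _ _ := rfl
  map_zero' := rfl
  map_add' _ _ := rfl
  commutes' _ := rfl

theorem IsPolyMap.map_pullback {F : U → W} (hF : IsPolyMap F) :
    (PolyFun W).map (pullback F) ≤ PolyFun U ∧ ((PolyFun W).map (pullback F)).FG := by
  obtain ⟨κ, _, g, w, hg, h⟩ := hF
  have hsub : pullback F '' {f : W → ℂ | IsLinearMap ℂ f} ⊆ span ℂ (Set.range g) := by
    rintro _ ⟨f, hf, rfl⟩
    have : pullback F f = ∑ k, f (w k) • g k := by
      funext x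
      change (hf.mk' f) (F x) = _
      simp [h, mul_comm]
    rw [this]
    exact sum_mem fun k _ => smul_mem _ _ (subset_span ⟨k, rfl⟩)
  rw [PolyFun, AlgHom.map_adjoin]
  constructor
  · refine Algebra.adjoin_le (hsub.trans ?_)
    change span ℂ (Set.range g) ≤ Subalgebra.toSubmodule (PolyFun U)
    rw [span_le]
    rintro _ ⟨k, rfl⟩
    exact hg k
  · have hfg : (span ℂ (pullback F '' {f : W → ℂ | IsLinearMap ℂ f})).FG := by
      have := FiniteDimensional.span_of_finite ℂ (Set.finite_range g)
      exact Submodule.fg_iff_finiteDimensional _ |>.2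
        (Submodule.finiteDimensional_of_le (span_le.2 hsub))
    obtain ⟨s, hs⟩ := hfg
    exact ⟨s, by rw [← Algebra.adjoin_span, hs, Algebra.adjoin_span]⟩

theorem IsPolyMap.comp_mem {F : U → W} (hF : IsPolyMap F) {f : W → ℂ} (hf : f ∈ PolyFun W) :
    (fun x => f (F x)) ∈ PolyFun U :=
  hF.map_pullback.1 ⟨f, hf, rfl⟩

/-- The restriction of a polynomial function to a line is a polynomial. -/
theorem exists_polynomial_of_line {f : W → ℂ} (hf : f ∈ PolyFun W) (x y : W) :
    ∃ P : Polynomial ℂ, ∀ t : ℂ, f (x + t • y) = P.eval t := by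
  induction hf using Algebra.adjoin_induction with
  | mem f hf =>
    exact ⟨.C (f x) + .X * .C (f y), fun t => by
      rw [hf.map_add, hf.map_smul]; simp; ring⟩
  | algebraMap c => exact ⟨.C c, fun t => by simp⟩
  | add f g _ _ hf hg =>
    obtain ⟨P, hP⟩ := hf
    obtain ⟨Q, hQ⟩ := hg
    exact ⟨P + Q, fun t => by simp [hP, hQ]⟩
  | mul f g _ _ hf hg =>
    obtain ⟨P, hP⟩ := hf
    obtain ⟨Q, hQ⟩ := hg
    exact ⟨P * Q, fun t => by simp [hP, hQ]⟩

/-- A polynomial function vanishing where a nonzero polynomial function does not vanish is zero. -/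
theorem polyFun_eq_zero_of_dense {f g : W → ℂ} (hf : f ∈ PolyFun W) (hg : g ∈ PolyFun W)
    {y : W} (hy : g y ≠ 0) (h : ∀ x, g x ≠ 0 → f x = 0) (x : W) : f x = 0 := by
  obtain ⟨P, hP⟩ := exists_polynomial_of_line hf x (y - x)
  obtain ⟨Q, hQ⟩ := exists_polynomial_of_line hg x (y - x)
  have hPQ : P * Q = 0 := Polynomial.funext fun t => by
    rw [Polynomial.eval_mul, ← hP, ← hQ, Polynomial.eval_zero, mul_eq_zero]
    by_contra! hne
    exact hne.1 (h _ hne.2)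
  have hQ0 : Q ≠ 0 := by
    rintro rfl
    exact hy (by simpa using hQ 1)
  have := hP 0
  rw [(mul_eq_zero.1 hPQ).resolve_right hQ0] at this
  simpa using this

/-- The ideal of polynomial functions vanishing on a set. -/
def vanIdeal (X : Set W) : Ideal (PolyFun W) where
  carrier := {f | ∀ x ∈ X, f.1 x = 0}
  add_mem' hf hg x hx := by simp [hf x hx, hg x hx]
  zero_mem' _ _ := rfl
  smul_mem' c f hf x hx := by simp [hf x hx]

theorem vanIdeal_anti {X Y : Set W} (h : X ⊆ Y) : vanIdeal Y ≤ vanIdeal X :=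
  fun _ hf x hx => hf x (h hx)

theorem subset_of_vanIdeal_le {X Y : Set W} (hY : IsAlgSet Y) (h : vanIdeal Y ≤ vanIdeal X) :
    X ⊆ Y := by
  obtain ⟨S, hS, rfl⟩ := hY
  intro x hx f hf
  exact h (x := ⟨f, hS hf⟩) (fun y hy => hy f hf) x hx

theorem IsIrrAlg.isPrime_vanIdeal {X : Set W} (hX : IsIrrAlg X) : (vanIdeal X).IsPrime := by
  obtain ⟨⟨x, hx⟩, -, hirr⟩ := hX
  refine ⟨fun h => ?_, fun {f g} hfg => ?_⟩
  · exact one_ne_zero (((Ideal.eq_top_iff_one _).1 h) x hx)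
  · exact hirr _ _ (isAlgSet_zero f.2) (isAlgSet_zero g.2)
      fun y hy => mul_eq_zero.1 (hfg y hy)

theorem trdeg_polyFun_le (n : ℕ) : Algebra.trdeg ℂ (PolyFun (Fin n → ℂ)) ≤ n := by
  let x : Fin n → PolyFun (Fin n → ℂ) := fun i => ⟨_, linear_mem_polyFun (LinearMap.proj i)⟩
  have hsurj : Function.Surjective (MvPolynomial.aeval (R := ℂ) x) := by
    have hle : PolyFun (Fin n → ℂ) ≤
        ((PolyFun (Fin n → ℂ)).val.comp (MvPolynomial.aeval (R := ℂ) x)).range := by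
      refine Algebra.adjoin_le fun f hf => ⟨∑ i, MvPolynomial.C (f fun j => if i = j then 1 else 0) *
        MvPolynomial.X i, ?_⟩
      funext v
      change _ = (hf.mk' f) v
      rw [LinearMap.pi_apply_eq_sum_univ (hf.mk' f) v]
      simp [x, mul_comm]
    intro f
    obtain ⟨p, hp⟩ := hle f.2
    exact ⟨p, Subtype.ext hp⟩
  simpa using trdeg_le_of_surjective _ hsurj

theorem adim_zcl_range_le {n : ℕ} {F : (Fin n → ℂ) → W} (hF : IsPolyMap F) :
    adim (zcl (Set.range F)) ≤ n := by
  refine sSup_le ?_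
  rintro _ ⟨m, rfl, c, hc, hirr⟩
  obtain ⟨hle, hfg⟩ := hF.map_pullback
  set B := (PolyFun W).map (pullback F)
  let ψ : PolyFun W →ₐ[ℂ] B :=
    ((pullback F).comp (PolyFun W).val).codRestrict B fun f => ⟨f.1, f.2, rfl⟩
  have hψ : Function.Surjective ψ := by
    rintro ⟨_, f, hf, rfl⟩
    exact ⟨⟨f, hf⟩, rfl⟩
  have hker (i) : RingHom.ker ψ ≤ vanIdeal (c i) := fun f hf x hx =>
    eq_zero_of_mem_zcl f.2 (by
      rintro _ ⟨u, rfl⟩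
      exact congrFun (congrArg Subtype.val (RingHom.mem_ker.1 hf)) u) ((hirr i).2 hx)
  have : Algebra.FiniteType ℂ B := B.fg_iff_finiteType.1 hfg
  obtain ⟨s, g, hinj, hint⟩ := exists_integral_inj_algHom_of_fg ℂ B
  have hs : s ≤ n := by
    have h1 : Algebra.trdeg ℂ (MvPolynomial (Fin s) ℂ) ≤ n :=
      (trdeg_le_of_injective ((Subalgebra.inclusion hle).comp g)
        ((Subalgebra.inclusion_injective hle).comp hinj)).trans (trdeg_polyFun_le n)
    simpa using h1
  let I (i) : Ideal B := (vanIdeal (c i)).map ψ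
  have hcomap (i) : (I i).comap ψ = vanIdeal (c i) := by
    rw [Ideal.comap_map_of_surjective _ hψ]
    exact sup_eq_left.2 (hker i)
  have hI (i) : (I i).IsPrime :=
    have := (hirr i).1.isPrime_vanIdeal
    Ideal.map_isPrime_of_surjective hψ (hker i)
  have hlt {i j} (h : i < j) : I j < I i := by
    refine lt_of_le_not_ge (Ideal.map_mono (vanIdeal_anti (hc h).le)) fun h' => ?_
    have := Ideal.comap_mono (f := ψ) h'
    rw [hcomap, hcomap] at this
    exact (hc h).not_ge (subset_of_vanIdeal_le (hirr i).1.2.1 this)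
  algebraize [g.toRingHom]
  let J : LTSeries (PrimeSpectrum (MvPolynomial (Fin s) ℂ)) :=
    { length := m
      toFun := fun i => ⟨(I i.rev).comap (algebraMap _ B), (hI _).comap _⟩
      step := fun i => by
        have := hI i.succ.rev
        have := hI i.castSucc.rev
        exact Ideal.IsIntegral.comap_lt_comap (hlt (Fin.rev_lt_rev.2 i.castSucc_lt_succ)) }
  have h1 := Order.LTSeries.length_le_krullDim J
  change (m : WithBot ℕ∞) ≤ ringKrullDim (MvPolynomial (Fin s) ℂ) at h1
  rw [MvPolynomial.ringKrullDim_of_isNoetherianRing] at h1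
  simp only [ringKrullDim_eq_zero_of_field, zero_add, Nat.card_eq_fintype_card,
    Fintype.card_fin] at h1
  exact_mod_cast (show m ≤ s by exact_mod_cast h1).trans hs

end Zariski

section TwistedCubic

/-- The cubic Veronese map `(s, t) ↦ (s³, s²t, st², t³)`. -/
def veronese (s t : ℂ) : Fin 4 → ℂ := ![s ^ 3, s ^ 2 * t, s * t ^ 2, t ^ 3]

theorem veronese_mul (k s t : ℂ) : veronese (k * s) (k * t) = k ^ 3 • veronese s t := by
  ext i
  fin_cases i <;> simp [veronese] <;> ring

theorem linearIndependent_veronese {r : Fin 3 → ℂ} (hr : Function.Injective r) :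
    LinearIndependent ℂ fun i => veronese 1 (r i) := by
  refine LinearIndependent.of_comp (LinearMap.funLeft ℂ ℂ (Fin.castSucc : Fin 3 → Fin 4)) ?_
  have h : LinearMap.funLeft ℂ ℂ (Fin.castSucc : Fin 3 → Fin 4) ∘ (fun i => veronese 1 (r i)) =
      (Matrix.vandermonde r).row := by
    ext i j
    fin_cases j <;> simp [veronese, LinearMap.funLeft_apply]
  rw [h]
  exact Matrix.linearIndependent_rows_of_det_ne_zero (Matrix.det_vandermonde_ne_zero_iff.2 hr)

theorem finrank_span_veronese {r : Fin 3 → ℂ} (hr : Function.Injective r) :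
    Module.finrank ℂ (span ℂ (Set.range fun i => veronese 1 (r i))) = 3 := by
  simpa using finrank_span_eq_card (linearIndependent_veronese hr)

theorem span_veronese_eq_ker {r : Fin 3 → ℂ} (hr : Function.Injective r)
    {f : (Fin 4 → ℂ) →ₗ[ℂ] ℂ} (hf : f ≠ 0) (h : ∀ i, f (veronese 1 (r i)) = 0) :
    span ℂ (Set.range fun i => veronese 1 (r i)) = LinearMap.ker f := by
  refine Submodule.eq_of_le_of_finrank_eq (span_le.2 ?_) ?_
  · rintro _ ⟨i, rfl⟩
    exact h i
  · have := Module.Dual.finrank_ker_add_one_of_ne_zero hf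
    rw [finrank_span_veronese hr]
    simp at this
    omega

/-- The binary cubic cut out on the twisted cubic by a linear form. -/
def cubicOfForm (f : (Fin 4 → ℂ) →ₗ[ℂ] ℂ) : Cubic ℂ :=
  ⟨f (Pi.single 3 1), f (Pi.single 2 1), f (Pi.single 1 1), f (Pi.single 0 1)⟩

theorem form_veronese (f : (Fin 4 → ℂ) →ₗ[ℂ] ℂ) (r : ℂ) :
    f (veronese 1 r) = (cubicOfForm f).toPoly.eval r := by
  have h : veronese 1 r = ∑ i, veronese 1 r i • Pi.single i (1 : ℂ) :=
    pi_eq_sum_univ' _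
  rw [h]
  simp [Fin.sum_univ_four, veronese, Cubic.toPoly, cubicOfForm]
  ring

theorem exists_roots_of_discr_ne_zero {P : Cubic ℂ} (ha : P.a ≠ 0) (hd : P.discr ≠ 0) :
    ∃ r : Fin 3 → ℂ, Function.Injective r ∧ ∀ i, P.toPoly.eval (r i) = 0 := by
  have hs : (P.toPoly.map (RingHom.id ℂ)).Splits := IsAlgClosed.splits _
  obtain ⟨x, y, z, h3⟩ := (Cubic.splits_iff_roots_eq_three ha).1 hs
  obtain ⟨hxy, hxz, hyz⟩ := (Cubic.discr_ne_zero_iff_roots_ne ha h3).1 hd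
  have hroot : ∀ w ∈ ({x, y, z} : Multiset ℂ), P.toPoly.eval w = 0 := by
    intro w hw
    rw [← h3, Cubic.map_roots, Polynomial.map_id] at hw
    exact Polynomial.isRoot_of_mem_roots hw
  refine ⟨![x, y, z], ?_, ?_⟩
  · intro i j
    fin_cases i <;> fin_cases j <;> simp [hxy, hxz, hyz, hxy.symm, hxz.symm, hyz.symm]
  · intro i
    fin_cases i <;> exact hroot _ (by simp)

/-- A line in a plane meeting the twisted cubic in three distinct points lies in infinitely many
such planes. -/
theorem infinite_trisecant_planes {r : Fin 3 → ℂ} (hr : Function.Injective r)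
    {L : Submodule ℂ (Fin 4 → ℂ)} (hL : Module.finrank ℂ L = 2)
    (hle : L ≤ span ℂ (Set.range fun i => veronese 1 (r i))) :
    {U : Submodule ℂ (Fin 4 → ℂ) | Module.finrank ℂ U = 3 ∧ L ≤ U ∧
      ∃ r' : Fin 3 → ℂ, U = span ℂ (Set.range fun i => veronese 1 (r' i))}.Infinite := by
  obtain ⟨x, hx, hxL⟩ : ∃ x ∈ span ℂ (Set.range fun i => veronese 1 (r i)), x ∉ L := by
    by_contra! h
    have := Submodule.finrank_mono (show _ ≤ L from h)
    rw [finrank_span_veronese hr] at this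
    omega
  obtain ⟨g, hgx, hgL⟩ := L.exists_le_ker_of_notMem hxL
  let f : (Fin 4 → ℂ) →ₗ[ℂ] ℂ := LinearMap.proj 3 - (r 0 + r 1 + r 2) • LinearMap.proj 2 +
    (r 0 * r 1 + r 0 * r 2 + r 1 * r 2) • LinearMap.proj 1 - (r 0 * r 1 * r 2) • LinearMap.proj 0
  have hf0 : f ≠ 0 := fun h => by
    have := LinearMap.congr_fun h (Pi.single 3 1)
    simp [f] at this
  have hfr (i) : f (veronese 1 (r i)) = 0 := by
    fin_cases i <;> simp [f, veronese] <;> ring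
  have hker := span_veronese_eq_ker hr hf0 hfr
  rw [hker] at hle hx
  let P : Cubic (Polynomial ℂ) :=
    ⟨.C (f (Pi.single 3 1)) + .X * .C (g (Pi.single 3 1)),
      .C (f (Pi.single 2 1)) + .X * .C (g (Pi.single 2 1)),
      .C (f (Pi.single 1 1)) + .X * .C (g (Pi.single 1 1)),
      .C (f (Pi.single 0 1)) + .X * .C (g (Pi.single 0 1))⟩
  have hPa (e : ℂ) : P.a.eval e = (cubicOfForm (f + e • g)).a := by
    simp [P, cubicOfForm]; ring
  have hPd (e : ℂ) : P.discr.eval e = (cubicOfForm (f + e • g)).discr := by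
    simp [P, cubicOfForm, Cubic.discr]; ring
  have hQ : P.a * P.discr ≠ 0 := fun h => by
    have h0 := congrArg (Polynomial.eval 0) h
    have ha : (cubicOfForm f).a = 1 := by simp [cubicOfForm, f]
    have hd : (cubicOfForm f).discr = ((r 0 - r 1) * (r 0 - r 2) * (r 1 - r 2)) ^ 2 := by
      simp [cubicOfForm, f, Cubic.discr]; ring
    rw [Polynomial.eval_mul, hPa, hPd, zero_smul, add_zero, ha, hd] at h0
    simp [sub_eq_zero, hr.eq_iff] at h0
  have hinf : {e : ℂ | ¬ (P.a * P.discr).IsRoot e}.Infinite :=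
    (Polynomial.finite_setOfPred_isRoot hQ).infinite_compl
  have hne {e : ℂ} (ha : (cubicOfForm (f + e • g)).a ≠ 0) : f + e • g ≠ 0 := fun h => ha (by
    simp [h, cubicOfForm])
  refine Set.infinite_of_injOn_mapsTo (f := fun e => LinearMap.ker (f + e • g)) ?_ ?_ hinf
  · intro e he e' _ hee
    by_contra hne'
    simp only [Set.mem_ofPred_eq, Polynomial.IsRoot, Polynomial.eval_mul, mul_eq_zero, not_or,
      hPa, hPd] at he
    have hsub {y} (hy : y ∈ LinearMap.ker (f + e • g)) : f y = 0 ∧ g y = 0 := by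
      have h1 : f y + e * g y = 0 := by simpa using hy
      have h2 : f y + e' * g y = 0 := by
        have : y ∈ LinearMap.ker (f + e' • g) := by
          rw [← show LinearMap.ker (f + e • g) = LinearMap.ker (f + e' • g) from hee]; exact hy
        simpa using this
      have h3 : g y = 0 := by
        have : (e - e') * g y = 0 := by linear_combination h1 - h2
        exact (mul_eq_zero.1 this).resolve_left (sub_ne_zero.2 hne')
      exact ⟨by simpa [h3] using h1, h3⟩
    have h1 := Module.Dual.finrank_ker_add_one_of_ne_zero (hne he.1)
    have h2 := Module.Dual.finrank_ker_add_one_of_ne_zero hf0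
    have heq : LinearMap.ker (f + e • g) = LinearMap.ker f :=
      Submodule.eq_of_le_of_finrank_eq (fun y hy => (hsub hy).1) (by omega)
    exact hgx (hsub (heq ▸ hx)).2
  · intro e he
    simp only [Set.mem_ofPred_eq, Polynomial.IsRoot, Polynomial.eval_mul, mul_eq_zero, not_or,
      hPa, hPd] at he
    obtain ⟨r', hr', hroot⟩ := exists_roots_of_discr_ne_zero he.1 he.2
    have hs := span_veronese_eq_ker hr' (hne he.1) fun i => by rw [form_veronese, hroot]
    refine ⟨?_, fun y hy => ?_, r', hs.symm⟩
    · change Module.finrank ℂ (LinearMap.ker (f + e • g)) = 3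
      rw [← hs]
      exact finrank_span_veronese hr'
    have h1 : f y = 0 := hle hy
    have h2 : g y = 0 := hgL hy
    simp [h1, h2]

end TwistedCubic

section Scroll

/-- The parametrization of the affine cone over the `(2,1)`-embedded quadric. -/
def scrollPoint (s t u v : ℂ) : Fin 6 → ℂ :=
  ![u * s ^ 2, v * s ^ 2, u * s * t, v * s * t, u * t ^ 2, v * t ^ 2]

theorem scrollPoint_mem (s t u v : ℂ) : scrollPoint s t u v ∈ Scroll21 :=
  subset_zcl _ ⟨((s, t), (u, v)), rfl⟩

theorem exists_scrollPoint {x : Fin 6 → ℂ} (hx : x ∈ Scroll21) :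
    ∃ s t u v, x = scrollPoint s t u v := by
  have hp (i : Fin 6) : (fun x : Fin 6 → ℂ => x i) ∈ PolyFun (Fin 6 → ℂ) :=
    linear_mem_polyFun (LinearMap.proj (R := ℂ) (φ := fun _ : Fin 6 => ℂ) i)
  have hq (i j k l : Fin 6) (h : ∀ s t u v, scrollPoint s t u v i * scrollPoint s t u v j -
      scrollPoint s t u v k * scrollPoint s t u v l = 0) : x i * x j - x k * x l = 0 :=
    eq_zero_of_mem_zcl (sub_mem (mul_mem (hp i) (hp j)) (mul_mem (hp k) (hp l)))
      (by rintro _ ⟨⟨⟨s, t⟩, u, v⟩, rfl⟩; exact h s t u v) hx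
  have h1 := hq 0 3 1 2 (by intros; simp [scrollPoint]; ring)
  have h2 := hq 0 5 1 4 (by intros; simp [scrollPoint]; ring)
  have h3 := hq 0 4 2 2 (by intros; simp [scrollPoint]; ring)
  have h4 := hq 1 5 3 3 (by intros; simp [scrollPoint]; ring)
  have h5 := hq 0 5 2 3 (by intros; simp [scrollPoint]; ring)
  by_cases h0 : x 0 = 0
  · have hx2 : x 2 = 0 := by simpa [h0] using h3
    by_cases h0' : x 1 = 0
    · have hx3 : x 3 = 0 := by simpa [h0'] using h4
      refine ⟨0, 1, x 4, x 5, ?_⟩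
      ext i
      fin_cases i <;> simp [scrollPoint, *]
    · have hx4 : x 4 = 0 := by simpa [h0, h0'] using h2
      refine ⟨1, x 3 / x 1, x 0, x 1, ?_⟩
      ext i
      fin_cases i <;> simp [scrollPoint, h0, hx2, hx4] <;> field_simp
      linear_combination h4
  · refine ⟨1, x 2 / x 0, x 0, x 1, ?_⟩
    ext i
    fin_cases i <;> simp [scrollPoint] <;> field_simp
    · linear_combination h1
    · linear_combination h3
    · linear_combination x 0 * h5 + x 2 * h1

/-- The linear map whose composite with the Veronese map parametrizes the image in the scroll of
the graph of the linear map with matrix `m`. -/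
def cubicMap (m : Fin 4 → ℂ) : (Fin 4 → ℂ) →ₗ[ℂ] (Fin 6 → ℂ) :=
  Matrix.mulVecLin !![m 0, m 1, 0, 0; m 2, m 3, 0, 0; 0, m 0, m 1, 0; 0, m 2, m 3, 0;
    0, 0, m 0, m 1; 0, 0, m 2, m 3]

theorem cubicMap_apply (m w : Fin 4 → ℂ) : cubicMap m w =
    ![m 0 * w 0 + m 1 * w 1, m 2 * w 0 + m 3 * w 1, m 0 * w 1 + m 1 * w 2,
      m 2 * w 1 + m 3 * w 2, m 0 * w 2 + m 1 * w 3, m 2 * w 2 + m 3 * w 3] := by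
  ext i
  fin_cases i <;> simp [cubicMap, Matrix.mulVec, dotProduct, Fin.sum_univ_four]

theorem cubicMap_smul (c : ℂ) (m w : Fin 4 → ℂ) : cubicMap (c • m) w = c • cubicMap m w := by
  rw [cubicMap_apply, cubicMap_apply]
  ext i
  fin_cases i <;> simp <;> ring

theorem cubicMap_veronese (m : Fin 4 → ℂ) (s t : ℂ) :
    cubicMap m (veronese s t) = scrollPoint s t (m 0 * s + m 1 * t) (m 2 * s + m 3 * t) := by
  rw [cubicMap_apply]
  ext i
  fin_cases i <;> simp [veronese, scrollPoint] <;> ring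

theorem cubicMap_injective {m : Fin 4 → ℂ} (hm : m 0 * m 3 - m 1 * m 2 ≠ 0) :
    Function.Injective (cubicMap m) := by
  rw [← LinearMap.ker_eq_bot, LinearMap.ker_eq_bot']
  intro w hw
  rw [cubicMap_apply] at hw
  have h (i) := congrFun hw i
  have h0 := h 0
  have h1 := h 1
  have h4 := h 4
  have h5 := h 5
  simp at h0 h1 h4 h5
  ext i
  refine (mul_eq_zero.1 ?_).resolve_left hm
  fin_cases i <;> simp only [Fin.zero_eta, Fin.mk_one, Fin.reduceFinMk]
  · linear_combination m 3 * h0 - m 1 * h1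
  · linear_combination m 0 * h1 - m 2 * h0
  · linear_combination m 3 * h4 - m 1 * h5
  · linear_combination m 0 * h5 - m 2 * h4

/-- A polynomial function on triples whose nonvanishing makes a triple of points of the scroll
general: no two lie on a common member of either ruling. -/
def genericForm (p : Fin 3 → Fin 6 → ℂ) : ℂ :=
  ((p 0 0 * p 1 1 - p 0 1 * p 1 0) * (p 0 0 * p 2 1 - p 0 1 * p 2 0) *
    (p 1 0 * p 2 1 - p 1 1 * p 2 0)) *
  ((p 0 0 * p 1 2 - p 0 2 * p 1 0) * (p 0 0 * p 2 2 - p 0 2 * p 2 0) *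
    (p 1 0 * p 2 2 - p 1 2 * p 2 0))

/-- Three general points of the scroll lie on the image of the graph of a Möbius
transformation. -/
theorem exists_cubicMap {p : Fin 3 → Fin 6 → ℂ} (hp : ∀ i, p i ∈ Scroll21)
    (hg : genericForm p ≠ 0) :
    ∃ m r k : _ → ℂ, m 0 * m 3 - m 1 * m 2 ≠ 0 ∧ Function.Injective r ∧ (∀ i, k i ≠ 0) ∧
      ∀ i : Fin 3, p i = k i • cubicMap m (veronese 1 (r i)) := by
  choose s t u v h using fun i => exists_scrollPoint (hp i)
  have hval (i) : p i 0 = u i * s i ^ 2 ∧ p i 1 = v i * s i ^ 2 ∧ p i 2 = u i * s i * t i := by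
    simp [h, scrollPoint]
  have hu (i j) : p i 0 * p j 1 - p i 1 * p j 0 =
      s i ^ 2 * s j ^ 2 * (u i * v j - u j * v i) := by
    rw [(hval i).1, (hval i).2.1, (hval j).1, (hval j).2.1]; ring
  have ht (i j) : p i 0 * p j 2 - p i 2 * p j 0 =
      u i * s i * (u j * s j) * (s i * t j - s j * t i) := by
    rw [(hval i).1, (hval i).2.2, (hval j).1, (hval j).2.2]; ring
  simp only [genericForm, hu, ht, mul_ne_zero_iff, pow_ne_zero_iff, ne_eq, OfNat.ofNat_ne_zero,
    not_false_eq_true] at hg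
  obtain ⟨⟨⟨⟨⟨hs0, hs1⟩, hU01⟩, ⟨⟨-, hs2⟩, hU02⟩⟩, ⟨-, hU12⟩⟩, ⟨⟨⟨-, hT01⟩, ⟨-, hT02⟩⟩, ⟨-, hT12⟩⟩⟩ :=
    hg
  set T01 := s 0 * t 1 - s 1 * t 0
  set T02 := s 0 * t 2 - s 2 * t 0
  set T12 := s 1 * t 2 - s 2 * t 1
  set U01 := u 0 * v 1 - u 1 * v 0
  set U02 := u 0 * v 2 - u 2 * v 0
  set U12 := u 1 * v 2 - u 2 * v 1
  let μ : Fin 3 → ℂ := ![U12 * T02 * T01, U02 * T01 * T12, T02 * T12 * U01]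
  let m : Fin 4 → ℂ := ![μ 0 * u 0 * t 1 - μ 1 * u 1 * t 0, s 0 * μ 1 * u 1 - s 1 * μ 0 * u 0,
    μ 0 * v 0 * t 1 - μ 1 * v 1 * t 0, s 0 * μ 1 * v 1 - s 1 * μ 0 * v 0]
  have hs (i) : s i ≠ 0 := by fin_cases i <;> assumption
  have hμ (i) : T01 * μ i ≠ 0 := by
    fin_cases i <;> simp [μ, hT01, hT02, hT12, hU01, hU02, hU12]
  have hmu (i) : m 0 * s i + m 1 * t i = T01 * μ i * u i := by
    fin_cases i <;> simp [m, μ, T01, T02, T12, U01, U02, U12] <;> ring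
  have hmv (i) : m 2 * s i + m 3 * t i = T01 * μ i * v i := by
    fin_cases i <;> simp [m, μ, T01, T02, T12, U01, U02, U12] <;> ring
  refine ⟨m, fun i => t i / s i, fun i => s i ^ 3 / (T01 * μ i), ?_, ?_, ?_, ?_⟩
  · have : m 0 * m 3 - m 1 * m 2 = T01 * μ 0 * μ 1 * U01 := by
      simp [m, T01, U01]; ring
    rw [this]
    exact mul_ne_zero (mul_ne_zero (hμ 0) (right_ne_zero_of_mul (hμ 1))) hU01
  · have hT (i j) (hij : t i / s i = t j / s j) : s i * t j - s j * t i = 0 := by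
      rw [div_eq_div_iff (hs i) (hs j)] at hij
      linear_combination -hij
    intro i j hij
    have h1 := hT i j hij
    have h2 := hT j i hij.symm
    fin_cases i <;> fin_cases j <;> first | rfl | (exfalso; tauto)
  · exact fun i => div_ne_zero (pow_ne_zero _ (hs i)) (hμ i)
  · intro i
    have h1 : s i ^ 3 • veronese 1 (t i / s i) = veronese (s i) (t i) := by
      rw [← veronese_mul, mul_one, mul_div_cancel₀ _ (hs i)]
    change p i = (s i ^ 3 / (T01 * μ i)) • cubicMap m (veronese 1 (t i / s i))
    rw [div_eq_inv_mul, mul_smul, ← map_smul, h1, cubicMap_veronese, hmu, hmv, h]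
    have hT := left_ne_zero_of_mul (hμ i)
    have hm := right_ne_zero_of_mul (hμ i)
    ext j
    fin_cases j <;> simp only [scrollPoint, Pi.smul_apply, smul_eq_mul] <;> simp <;> field_simp

end Scroll

section Wedge

variable {U : Type*} [AddCommGroup U] [Module ℂ U]

theorem polyFun_add {f g : U → ℂ} (hf : f ∈ PolyFun U) (hg : g ∈ PolyFun U) :
    (fun x => f x + g x) ∈ PolyFun U := add_mem hf hg

theorem polyFun_sub {f g : U → ℂ} (hf : f ∈ PolyFun U) (hg : g ∈ PolyFun U) :
    (fun x => f x - g x) ∈ PolyFun U := sub_mem hf hg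

theorem polyFun_mul {f g : U → ℂ} (hf : f ∈ PolyFun U) (hg : g ∈ PolyFun U) :
    (fun x => f x * g x) ∈ PolyFun U := mul_mem hf hg

theorem polyFun_pow {f : U → ℂ} (hf : f ∈ PolyFun U) (n : ℕ) :
    (fun x => f x ^ n) ∈ PolyFun U := pow_mem hf n

theorem ι_add_mul_ι_add {W : Type*} [AddCommGroup W] [Module ℂ W] (x y : W) (a b c d : ℂ) :
    ExteriorAlgebra.ι ℂ (a • x + b • y) * ExteriorAlgebra.ι ℂ (c • x + d • y) =
      (a * d - b * c) • (ExteriorAlgebra.ι ℂ x * ExteriorAlgebra.ι ℂ y) := by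
  have h : ExteriorAlgebra.ι ℂ y * ExteriorAlgebra.ι ℂ x =
      -(ExteriorAlgebra.ι ℂ x * ExteriorAlgebra.ι ℂ y) :=
    eq_neg_of_add_eq_zero_right (ExteriorAlgebra.ι_add_mul_swap x y)
  simp only [map_add, map_smul, add_mul, mul_add, smul_mul_smul_comm, ExteriorAlgebra.ι_sq_zero, h]
  module

theorem isPolyMap_wedge {n : ℕ} {q q' : U → Fin n → ℂ} (hq : ∀ i, (fun x => q x i) ∈ PolyFun U)
    (hq' : ∀ i, (fun x => q' x i) ∈ PolyFun U) :
    IsPolyMap fun x => ExteriorAlgebra.ι ℂ (q x) * ExteriorAlgebra.ι ℂ (q' x) := by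
  refine ⟨Fin n × Fin n, inferInstance, fun k x => q x k.1 * q' x k.2,
    fun k => ExteriorAlgebra.ι ℂ (Pi.single k.1 1) * ExteriorAlgebra.ι ℂ (Pi.single k.2 1),
    fun k => polyFun_mul (hq _) (hq' _), fun x => ?_⟩
  have h (w : Fin n → ℂ) : ExteriorAlgebra.ι ℂ w =
      ∑ i, w i • ExteriorAlgebra.ι ℂ (Pi.single i (1 : ℂ)) := by
    conv_lhs => rw [pi_eq_sum_univ' w]
    simp
  beta_reduce
  rw [h (q x), h (q' x), Finset.sum_mul_sum, Fintype.sum_prod_type]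
  simp only [smul_mul_smul_comm]

theorem polyFun_cubicMap {m w : U → Fin 4 → ℂ} (hm : ∀ i, (fun x => m x i) ∈ PolyFun U)
    (hw : ∀ i, (fun x => w x i) ∈ PolyFun U) (i : Fin 6) :
    (fun x => cubicMap (m x) (w x) i) ∈ PolyFun U := by
  simp only [cubicMap_apply]
  fin_cases i <;> exact polyFun_add (polyFun_mul (hm _) (hw _)) (polyFun_mul (hm _) (hw _))

theorem polyFun_genericForm {p : U → Fin 3 → Fin 6 → ℂ}
    (hp : ∀ i j, (fun x => p x i j) ∈ PolyFun U) :
    (fun x => genericForm (p x)) ∈ PolyFun U := by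
  have h (i j k l i' j' k' l') :
      (fun x => p x i j * p x k l - p x i' j' * p x k' l') ∈ PolyFun U :=
    polyFun_sub (polyFun_mul (hp _ _) (hp _ _)) (polyFun_mul (hp _ _) (hp _ _))
  unfold genericForm
  refine polyFun_mul (polyFun_mul (polyFun_mul ?_ ?_) ?_) (polyFun_mul (polyFun_mul ?_ ?_) ?_) <;>
    exact h _ _ _ _ _ _ _ _

/-- A normalized line in the space of a twisted cubic on the scroll, in Plücker coordinates. -/
def normalLine (z : Fin 8 → ℂ) : ExteriorAlgebra ℂ (Fin 6 → ℂ) :=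
  ExteriorAlgebra.ι ℂ (cubicMap ![z 0, z 1, z 2, z 3] ![1, 0, z 4, z 5]) *
    ExteriorAlgebra.ι ℂ (cubicMap ![z 0, z 1, z 2, z 3] ![0, 1, z 6, z 7])

theorem isPolyMap_normalLine : IsPolyMap normalLine := by
  have hz (i : Fin 8) : (fun z : Fin 8 → ℂ => z i) ∈ PolyFun (Fin 8 → ℂ) :=
    linear_mem_polyFun (LinearMap.proj (R := ℂ) (φ := fun _ : Fin 8 => ℂ) i)
  have hm (i : Fin 4) : (fun z : Fin 8 → ℂ => ![z 0, z 1, z 2, z 3] i) ∈ PolyFun (Fin 8 → ℂ) := by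
    fin_cases i <;> exact hz _
  refine isPolyMap_wedge (polyFun_cubicMap hm fun i => ?_) (polyFun_cubicMap hm fun i => ?_) <;>
    fin_cases i <;> first | exact hz _ | exact const_mem_polyFun _

theorem cubicMap_wedge_mem (m w w' : Fin 4 → ℂ) :
    ExteriorAlgebra.ι ℂ (cubicMap m w) * ExteriorAlgebra.ι ℂ (cubicMap m w') ∈
      zcl (Set.range normalLine) := by
  refine mem_zcl_of_forall fun f hf h => ?_
  have hx (i) : (fun x : (Fin 4 → ℂ) × (Fin 4 → ℂ) × (Fin 4 → ℂ) => x.1 i) ∈ PolyFun _ :=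
    linear_mem_polyFun (W := (Fin 4 → ℂ) × (Fin 4 → ℂ) × (Fin 4 → ℂ))
      (LinearMap.proj (R := ℂ) (φ := fun _ : Fin 4 => ℂ) i ∘ₗ LinearMap.fst ℂ _ _)
  have hy (i) : (fun x : (Fin 4 → ℂ) × (Fin 4 → ℂ) × (Fin 4 → ℂ) => x.2.1 i) ∈ PolyFun _ :=
    linear_mem_polyFun (W := (Fin 4 → ℂ) × (Fin 4 → ℂ) × (Fin 4 → ℂ))
      (LinearMap.proj (R := ℂ) (φ := fun _ : Fin 4 => ℂ) i ∘ₗ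
        LinearMap.fst ℂ (Fin 4 → ℂ) (Fin 4 → ℂ) ∘ₗ LinearMap.snd ℂ _ _)
  have hz (i) : (fun x : (Fin 4 → ℂ) × (Fin 4 → ℂ) × (Fin 4 → ℂ) => x.2.2 i) ∈ PolyFun _ :=
    linear_mem_polyFun (W := (Fin 4 → ℂ) × (Fin 4 → ℂ) × (Fin 4 → ℂ))
      (LinearMap.proj (R := ℂ) (φ := fun _ : Fin 4 => ℂ) i ∘ₗ
        LinearMap.snd ℂ (Fin 4 → ℂ) (Fin 4 → ℂ) ∘ₗ LinearMap.snd ℂ _ _)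
  have hdet : (fun x : (Fin 4 → ℂ) × (Fin 4 → ℂ) × (Fin 4 → ℂ) =>
      x.2.1 0 * x.2.2 1 - x.2.1 1 * x.2.2 0) ∈ PolyFun _ :=
    polyFun_sub (polyFun_mul (hy 0) (hz 1)) (polyFun_mul (hy 1) (hz 0))
  refine polyFun_eq_zero_of_dense
    ((isPolyMap_wedge (polyFun_cubicMap hx hy) (polyFun_cubicMap hx hz)).comp_mem hf)
    hdet
    (y := (0, Pi.single 0 1, Pi.single 1 1)) (by simp) ?_ (m, w, w')
  clear m w w'
  rintro ⟨m, w, w'⟩ hd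
  dsimp only at hd ⊢
  set δ := w 0 * w' 1 - w 1 * w' 0 with hδ
  obtain ⟨c, hc⟩ := IsAlgClosed.exists_pow_nat_eq δ (n := 2) two_pos
  let a (i : Fin 4) : ℂ := (w' 1 * w i - w 1 * w' i) / δ
  let b (i : Fin 4) : ℂ := (w 0 * w' i - w' 0 * w i) / δ
  let z : Fin 8 → ℂ := ![c * m 0, c * m 1, c * m 2, c * m 3, a 2, a 3, b 2, b 3]
  suffices hz : ExteriorAlgebra.ι ℂ (cubicMap m w) * ExteriorAlgebra.ι ℂ (cubicMap m w') =
      normalLine z from hz ▸ h _ ⟨z, rfl⟩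
  have hm : (![z 0, z 1, z 2, z 3] : Fin 4 → ℂ) = c • m := by
    ext i; fin_cases i <;> rfl
  have hw : w = w 0 • ![1, 0, a 2, a 3] + w 1 • ![0, 1, b 2, b 3] := by
    ext i
    fin_cases i <;> simp [a, b] <;> field_simp <;> rw [hδ] <;> ring
  have hw' : w' = w' 0 • ![1, 0, a 2, a 3] + w' 1 • ![0, 1, b 2, b 3] := by
    ext i
    fin_cases i <;> simp [a, b] <;> field_simp <;> rw [hδ] <;> ring
  have hz4 : (![1, 0, z 4, z 5] : Fin 4 → ℂ) = ![1, 0, a 2, a 3] := rfl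
  have hz6 : (![0, 1, z 6, z 7] : Fin 4 → ℂ) = ![0, 1, b 2, b 3] := rfl
  rw [normalLine, hm, hz4, hz6, cubicMap_smul, cubicMap_smul, map_smul, map_smul,
    smul_mul_smul_comm, ← pow_two, hc, hδ, ← ι_add_mul_ι_add, ← map_smul, ← map_smul, ← map_smul,
    ← map_smul, ← map_add, ← map_add, ← hw, ← hw']

/-- A sample triple of general points. -/
theorem genericForm_sample_ne_zero :
    genericForm (fun i => scrollPoint 1 (i.val : ℂ) 1 (i.val : ℂ)) ≠ 0 := by
  simp [genericForm, scrollPoint]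
  norm_num

theorem GhkConePre_subset : GhkConePre Scroll21 1 2 ⊆ zcl (Set.range normalLine) := by
  rintro _ ⟨p, q, hp, hq, rfl⟩
  choose s t u v h using fun i => exists_scrollPoint (hp i)
  choose c hc using fun j => (Submodule.mem_span_range_iff_exists_fun ℂ).1 (hq j)
  refine mem_zcl_of_forall fun f hf hv => ?_
  have hx (i j) : (fun x : (Fin 3 → Fin 4 → ℂ) × (Fin 2 → Fin 3 → ℂ) => x.1 i j) ∈ PolyFun _ :=
    linear_mem_polyFun (W := (Fin 3 → Fin 4 → ℂ) × (Fin 2 → Fin 3 → ℂ))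
      (LinearMap.proj (R := ℂ) (φ := fun _ : Fin 4 => ℂ) j ∘ₗ
        LinearMap.proj (R := ℂ) (φ := fun _ : Fin 3 => Fin 4 → ℂ) i ∘ₗ LinearMap.fst ℂ _ _)
  have hy (i j) : (fun x : (Fin 3 → Fin 4 → ℂ) × (Fin 2 → Fin 3 → ℂ) => x.2 i j) ∈ PolyFun _ :=
    linear_mem_polyFun (W := (Fin 3 → Fin 4 → ℂ) × (Fin 2 → Fin 3 → ℂ))
      (LinearMap.proj (R := ℂ) (φ := fun _ : Fin 3 => ℂ) j ∘ₗ
        LinearMap.proj (R := ℂ) (φ := fun _ : Fin 2 => Fin 3 → ℂ) i ∘ₗ LinearMap.snd ℂ _ _)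
  let P (x : (Fin 3 → Fin 4 → ℂ) × (Fin 2 → Fin 3 → ℂ)) (i : Fin 3) : Fin 6 → ℂ :=
    scrollPoint (x.1 i 0) (x.1 i 1) (x.1 i 2) (x.1 i 3)
  let Q (j : Fin 2) (x : (Fin 3 → Fin 4 → ℂ) × (Fin 2 → Fin 3 → ℂ)) : Fin 6 → ℂ :=
    ∑ i, x.2 j i • P x i
  have hP (i j) : (fun x => P x i j) ∈ PolyFun _ := by
    fin_cases j <;> first
      | exact polyFun_mul (hx _ _) (polyFun_pow (hx _ _) _)
      | exact polyFun_mul (polyFun_mul (hx _ _) (hx _ _)) (hx _ _)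
  have hQ (j i) : (fun x => Q j x i) ∈ PolyFun _ := by
    simp only [Q, Fin.sum_univ_three, Pi.add_apply, Pi.smul_apply, smul_eq_mul]
    exact polyFun_add (polyFun_add (polyFun_mul (hy _ _) (hP _ _)) (polyFun_mul (hy _ _) (hP _ _)))
      (polyFun_mul (hy _ _) (hP _ _))
  have key := polyFun_eq_zero_of_dense ((isPolyMap_wedge (hQ 0) (hQ 1)).comp_mem hf)
    (polyFun_genericForm hP) (y := (fun i => ![1, i.val, 1, i.val], 0))
    genericForm_sample_ne_zero (fun x hgx => ?_) (fun i => ![s i, t i, u i, v i], c)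
  · have hq' (j) : Q j (fun i => ![s i, t i, u i, v i], c) = q j := by
      rw [← hc j]
      refine Finset.sum_congr rfl fun i _ => ?_
      rw [h i]
      rfl
    rw [hq', hq'] at key
    simpa [ExteriorAlgebra.ιMulti_apply, List.ofFn_succ, Matrix.vecTail] using key
  · obtain ⟨m, r, k, -, -, -, hmr⟩ := exists_cubicMap (fun i => scrollPoint_mem _ _ _ _) hgx
    have hQm (j) : Q j x = cubicMap m (∑ i, x.2 j i • k i • veronese 1 (r i)) := by
      simp only [map_sum, map_smul, ← hmr, Q, P]
    rw [hQm, hQm]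
    exact eq_zero_of_mem_zcl hf hv (cubicMap_wedge_mem _ _ _)

theorem pdim_GhkCone_lt : pdim (GhkCone Scroll21 1 2) < 8 := by
  have h : adim (GhkCone Scroll21 1 2) ≤ 8 := by
    refine le_trans (sSup_le_sSup ?_) (adim_zcl_range_le isPolyMap_normalLine)
    rintro _ ⟨n, rfl, c, hc, h⟩
    exact ⟨n, rfl, c, hc, fun i => ⟨(h i).1, (h i).2.trans (zcl_subset_zcl GhkConePre_subset)⟩⟩
  calc pdim (GhkCone Scroll21 1 2) ≤ 8 - 1 := tsub_le_tsub_right h 1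
    _ < 8 := by decide

end Wedge

section Curve

theorem span_range_veronese_eq_top :
    span ℂ (Set.range fun st : ℂ × ℂ => veronese st.1 st.2) = ⊤ := by
  let r : Fin 4 → ℂ := fun i => (i.val : ℂ)
  have hr : Function.Injective r := fun i j h => Fin.ext (by simpa [r] using h)
  have hli : LinearIndependent ℂ fun i => veronese 1 (r i) := by
    have h : (fun i => veronese 1 (r i)) = (Matrix.vandermonde r).row := by
      ext i j
      fin_cases j <;> simp [veronese, Matrix.vandermonde]
    rw [h]
    exact Matrix.linearIndependent_rows_of_det_ne_zero (Matrix.det_vandermonde_ne_zero_iff.2 hr)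
  rw [eq_top_iff, ← hli.span_eq_top_of_card_eq_finrank' (by simp)]
  refine span_mono ?_
  rintro _ ⟨i, rfl⟩
  exact ⟨(1, r i), rfl⟩

/-- The cone over the twisted cubic in the scroll attached to an invertible matrix. -/
def cubicCone (m : Fin 4 → ℂ) : Set (Fin 6 → ℂ) :=
  zcl (Set.range fun st : ℂ × ℂ => cubicMap m (veronese st.1 st.2))

theorem cubicCone_subset (m : Fin 4 → ℂ) : cubicCone m ⊆ Scroll21 := by
  refine zcl_subset_zcl ?_
  rintro _ ⟨st, rfl⟩
  dsimp only
  rw [cubicMap_veronese]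
  exact scrollPoint_mem _ _ _ _

theorem smul_cubicMap_veronese_mem (m : Fin 4 → ℂ) (k r : ℂ) :
    k • cubicMap m (veronese 1 r) ∈ cubicCone m := by
  obtain ⟨c, rfl⟩ := IsAlgClosed.exists_pow_nat_eq k (n := 3) three_pos
  rw [← map_smul, ← veronese_mul]
  exact subset_zcl _ ⟨(c * 1, c * r), rfl⟩

theorem span_cubicCone (m : Fin 4 → ℂ) :
    span ℂ (cubicCone m) = LinearMap.range (cubicMap m) := by
  refine le_antisymm (span_le.2 (zcl_subset (isAlgSet_submodule _) ?_)) ?_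
  · rintro _ ⟨st, rfl⟩
    exact LinearMap.mem_range_self _ _
  · rw [LinearMap.range_eq_map, ← span_range_veronese_eq_top, map_span, ← Set.range_comp]
    exact span_mono (subset_zcl _)

theorem infinite_trisecant_planes_scroll {m : Fin 4 → ℂ} (hm : m 0 * m 3 - m 1 * m 2 ≠ 0)
    {r k : Fin 3 → ℂ} (hr : Function.Injective r) {L : Submodule ℂ (Fin 6 → ℂ)}
    (hL : Module.finrank ℂ L = 2)
    (hle : L ≤ span ℂ (Set.range fun i => k i • cubicMap m (veronese 1 (r i)))) :
    {U : Submodule ℂ (Fin 6 → ℂ) | Module.finrank ℂ U = 3 ∧ L ≤ U ∧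
      ∃ q : Fin 3 → Fin 6 → ℂ, (∀ i, q i ∈ Scroll21) ∧ span ℂ (Set.range q) = U}.Infinite := by
  have hinj := cubicMap_injective hm
  have hle' : L ≤ (span ℂ (Set.range fun i => veronese 1 (r i))).map (cubicMap m) := by
    refine hle.trans (span_le.2 ?_)
    rintro _ ⟨i, rfl⟩
    exact smul_mem _ _ (mem_map_of_mem (subset_span ⟨i, rfl⟩))
  have hmap : (L.comap (cubicMap m)).map (cubicMap m) = L :=
    map_comap_eq_of_le (hle'.trans (LinearMap.map_le_range))
  have hfin (U : Submodule ℂ (Fin 4 → ℂ)) :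
      Module.finrank ℂ (U.map (cubicMap m)) = Module.finrank ℂ U :=
    (equivMapOfInjective _ hinj U).finrank_eq.symm
  refine ((infinite_trisecant_planes hr (L := L.comap (cubicMap m)) ?_ ?_).image
    (map_injective_of_injective hinj).injOn).mono ?_
  · rw [← hfin, hmap, hL]
  · exact (comap_mono hle').trans_eq (comap_map_eq_of_injective hinj _)
  · rintro _ ⟨U, ⟨hU, hLU, r', rfl⟩, rfl⟩
    refine ⟨by rw [hfin, hU], hmap ▸ map_mono hLU,
      fun i => cubicMap m (veronese 1 (r' i)), fun i => ?_, ?_⟩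
    · beta_reduce
      rw [cubicMap_veronese]
      exact scrollPoint_mem _ _ _ _
    · rw [map_span, ← Set.range_comp]
      rfl

end Curve

/-- For the `(2,1)`-embedding `S` of a smooth quadric into `P^5`: through three general
points of `S` there passes a rational cubic curve contained in `S` spanning a `P^3`;
every line in the plane of the three points lies in infinitely many 3-secant planes;
and consequently `dim G_{1,2}(S) < 8`. -/
theorem scroll21_degenerate_G12 :
    (∃ Z : Set (Fin 3 → Fin 6 → ℂ), IsAlgSet Z ∧
      ¬ ({p : Fin 3 → Fin 6 → ℂ | ∀ i, p i ∈ Scroll21} ⊆ Z) ∧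
      ∀ p : Fin 3 → Fin 6 → ℂ, (∀ i, p i ∈ Scroll21) → p ∉ Z →
        (∃ (V : Submodule ℂ (Fin 6 → ℂ)) (a b c d : Fin 6 → ℂ)
            (C : Set (Fin 6 → ℂ)),
          Module.finrank ℂ V = 4 ∧
          C = zcl (Set.range fun st : ℂ × ℂ => fun j =>
            a j * st.1 ^ 3 + b j * st.1 ^ 2 * st.2 + c j * st.1 * st.2 ^ 2 +
              d j * st.2 ^ 3) ∧
          C ⊆ Scroll21 ∧ (∀ i, p i ∈ C) ∧ Submodule.span ℂ C = V) ∧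
        (∀ L : Submodule ℂ (Fin 6 → ℂ), Module.finrank ℂ L = 2 →
          L ≤ Submodule.span ℂ (Set.range p) →
          {U : Submodule ℂ (Fin 6 → ℂ) | Module.finrank ℂ U = 3 ∧ L ≤ U ∧
            ∃ q : Fin 3 → Fin 6 → ℂ, (∀ i, q i ∈ Scroll21) ∧
              Submodule.span ℂ (Set.range q) = U}.Infinite)) ∧
    pdim (GhkCone Scroll21 1 2) < 8 := by
  refine ⟨⟨{p | genericForm p = 0}, isAlgSet_zero (polyFun_genericForm fun i j => ?_), fun h => ?_,
    fun p hp hpZ => ?_⟩, pdim_GhkCone_lt⟩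
  · exact linear_mem_polyFun (LinearMap.proj (R := ℂ) (φ := fun _ : Fin 6 => ℂ) j ∘ₗ
      LinearMap.proj (R := ℂ) (φ := fun _ : Fin 3 => Fin 6 → ℂ) i)
  · exact genericForm_sample_ne_zero (h fun i => scrollPoint_mem _ _ _ _)
  · obtain ⟨m, r, k, hm, hr, -, hk⟩ := exists_cubicMap hp hpZ
    refine ⟨⟨LinearMap.range (cubicMap m), ![m 0, m 2, 0, 0, 0, 0], ![m 1, m 3, m 0, m 2, 0, 0],
      ![0, 0, m 1, m 3, m 0, m 2], ![0, 0, 0, 0, m 1, m 3], cubicCone m, ?_, ?_,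
      cubicCone_subset m, fun i => ?_, span_cubicCone m⟩, fun L hL hle => ?_⟩
    · rw [LinearMap.finrank_range_of_inj (cubicMap_injective hm)]
      simp
    · rw [cubicCone]
      congr! with st j
      rw [cubicMap_apply]
      fin_cases j <;> simp [veronese] <;> ring
    · rw [hk i]
      exact smul_cubicMap_veronese_mem _ _ _
    · rw [funext hk] at hle
      exact infinite_trisecant_planes_scroll hm hr hL hle
end
end
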